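/- Let α > 0 and p = 4/3. The set {e^{−1/(4α)} γ_n : n ≥ 1} (i.e. e^{−1/(4α)}Γ with its smallest-modulus point e^{−1/(4α)}γ_0 removed) is a complete interpolating sequence for F^{4/3}_φ if and only if the following three conditions hold: (a) Γ is d_ρ-separated; (b) the sequence (δ_n)_{n≥0} is bounded; (c) there exists an integer N ≥ 1 such that −1/(4α) < ∇_N ≤ Δ_N < 1/(4α). -/

import Mathlib

open MeasureTheory Complex
open scoped ENNReal

noncomputable section

/-- `log⁺ t = max (log t) 0`. -/
def logPlus (t : ℝ) : ℝ := max (Real.log t) 0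

/-- The weight `φ(z) = α (log⁺ |z|)²`. -/
def phi (α : ℝ) (z : ℂ) : ℝ := α * (logPlus ‖z‖) ^ 2

/-- `‖f‖_{p,φ}^p = ∫_ℂ |f(z) e^{-φ(z)}|^p dm(z)` as an extended nonnegative real. -/
def fockNormP (α p : ℝ) (f : ℂ → ℂ) : ℝ≥0∞ :=
  ∫⁻ z : ℂ, ENNReal.ofReal ((‖f z‖ * Real.exp (-(phi α z))) ^ p)

/-- Membership in the Fock space `F^p_φ`: entire and finite norm. -/
def MemFock (α p : ℝ) (f : ℂ → ℂ) : Prop :=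
  Differentiable ℂ f ∧ fockNormP α p f < ⊤

/-- The discrete norm `‖f‖_{p,φ,Λ}^p = Σ_{λ∈Λ} (1+|λ|)² |f(λ)|^p e^{-pφ(λ)}`. -/
def discNormP (α p : ℝ) (Λ : Set ℂ) (f : ℂ → ℂ) : ℝ≥0∞ :=
  ∑' lam : Λ, ENNReal.ofReal
    ((1 + ‖(lam : ℂ)‖) ^ 2 * ‖f (lam : ℂ)‖ ^ p *
      Real.exp (-(p * phi α (lam : ℂ))))

/-- `Λ` is sampling for `F^p_φ`. -/
def Sampling (α p : ℝ) (Λ : Set ℂ) : Prop :=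
  ∃ C : ℝ, 1 ≤ C ∧ ∀ f : ℂ → ℂ, MemFock α p f →
    (ENNReal.ofReal C)⁻¹ * fockNormP α p f ≤ discNormP α p Λ f ∧
    discNormP α p Λ f ≤ ENNReal.ofReal C * fockNormP α p f

/-- `Λ` is interpolating for `F^p_φ`. -/
def Interpolating (α p : ℝ) (Λ : Set ℂ) : Prop :=
  ∀ v : ℂ → ℂ,
    (∑' lam : Λ, ENNReal.ofReal
      ((1 + ‖(lam : ℂ)‖) ^ 2 * ‖v (lam : ℂ)‖ ^ p *
        Real.exp (-(p * phi α (lam : ℂ))))) < ⊤ →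
    ∃ f : ℂ → ℂ, MemFock α p f ∧ ∀ lam ∈ Λ, f lam = v lam

/-- `Λ` is a complete interpolating sequence for `F^p_φ`. -/
def CompleteInterpolating (α p : ℝ) (Λ : Set ℂ) : Prop :=
  Sampling α p Λ ∧ Interpolating α p Λ

/-- `ρ(z) = |z| / √(2α)`. -/
def rhoF (α : ℝ) (z : ℂ) : ℝ := ‖z‖ / Real.sqrt (2 * α)

/-- `d_ρ(z,w) = |z-w| / (1 + min(ρ(z), ρ(w)))`. -/
def dRho (α : ℝ) (z w : ℂ) : ℝ :=
  ‖z - w‖ / (1 + min (rhoF α z) (rhoF α w))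

/-- `Λ` is `d_ρ`-separated. -/
def DRhoSeparated (α : ℝ) (Λ : Set ℂ) : Prop :=
  ∃ ε : ℝ, 0 < ε ∧ ∀ l ∈ Λ, ∀ l' ∈ Λ, l ≠ l' → ε ≤ dRho α l l'

/-- The average `(1/N) Σ_{k=n}^{n+N-1} δ_k`. -/
def avgD (δ : ℕ → ℝ) (N n : ℕ) : ℝ := (1 / (N : ℝ)) * ∑ k ∈ Finset.range N, δ (n + k)

lemma circle_le (h : ℂ → ℂ) (c : ℂ) (R r : ℝ) (hd : DifferentiableOn ℂ h (Metric.ball c R))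
    (hr : 0 < r) (hrR : r < R) :
    ∫⁻ _ in Set.Ioo (-Real.pi) Real.pi, ‖h c‖ₑ ≤
      ∫⁻ θ in Set.Ioo (-Real.pi) Real.pi, ‖h (c + Complex.polarCoord.symm (r, θ))‖ₑ := by
  have hsub : Metric.closedBall c r ⊆ Metric.ball c R := Metric.closedBall_subset_ball hrR
  have hdc : DiffContOnCl ℂ h (Metric.ball c |r|) := by
    rw [abs_of_pos hr]
    exact (hd.mono (by rw [closure_ball _ hr.ne']; exact hsub)).diffContOnCl
  have h1 := hdc.circleAverage
  have hper : Function.Periodic (fun θ => h (circleMap c r θ)) (2 * Real.pi) := by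
    intro θ; simp only; rw [periodic_circleMap c r θ]
  have h2 : ∫ θ in (0:ℝ)..(2 * Real.pi), h (circleMap c r θ)
      = ∫ θ in (-Real.pi)..Real.pi, h (circleMap c r θ) := by
    have := hper.intervalIntegral_add_eq 0 (-Real.pi)
    rw [zero_add] at this
    rw [this]; congr 1; ring
  have h3 : (2 * Real.pi : ℝ) • h c = ∫ θ in Set.Ioo (-Real.pi) Real.pi, h (circleMap c r θ) := by
    rw [← h1, Real.circleAverage_def, h2, smul_smul, mul_inv_cancel₀ (by positivity), one_smul,
      intervalIntegral.integral_of_le (by linarith [Real.pi_pos]),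
      MeasureTheory.integral_Ioc_eq_integral_Ioo]
  have h4 : ∫⁻ _ in Set.Ioo (-Real.pi) Real.pi, ‖h c‖ₑ = ‖(2 * Real.pi : ℝ) • h c‖ₑ := by
    rw [lintegral_const, enorm_smul, mul_comm]
    congr 1
    simp only [MeasurableSet.univ, Measure.restrict_apply, Set.univ_inter, Real.volume_Ioo]
    rw [Real.enorm_of_nonneg (by positivity)]; congr 1; ring
  rw [h4, h3]
  refine (enorm_integral_le_lintegral_enorm _).trans_eq ?_
  congr 1; ext θ
  congr 2
  rw [circleMap, Complex.polarCoord_symm_apply, Complex.exp_mul_I]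
  push_cast; ring_nf

lemma area_mean (h : ℂ → ℂ) (hm : Measurable h) (c : ℂ) (R : ℝ)
    (hd : DifferentiableOn ℂ h (Metric.ball c R)) :
    ‖h c‖ₑ * volume (Metric.ball c R) ≤ ∫⁻ x in Metric.ball c R, ‖h x‖ₑ := by
  have key : ∀ F : ℂ → ℝ≥0∞, Measurable F → ∫⁻ x in Metric.ball c R, F x =
      ∫⁻ r in Set.Ioi (0:ℝ), ∫⁻ θ in Set.Ioo (-Real.pi) Real.pi, ENNReal.ofReal r *
        (Metric.ball c R).indicator F (c + Complex.polarCoord.symm (r, θ)) := by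
    intro F hF
    rw [← lintegral_indicator Metric.isOpen_ball.measurableSet,
      ← lintegral_add_left_eq_self _ c, ← Complex.lintegral_comp_polarCoord_symm]
    rw [polarCoord_target, Measure.volume_eq_prod, ← Measure.prod_restrict, lintegral_prod]
    · rfl
    · apply Measurable.aemeasurable
      have : Measurable (fun p : ℝ × ℝ => Complex.polarCoord.symm p) := by
        simp only [Complex.polarCoord_symm_apply]; fun_prop
      refine Measurable.mul (f := fun p : ℝ × ℝ => ENNReal.ofReal p.1) (by fun_prop) ?_
      exact (hF.indicator Metric.isOpen_ball.measurableSet).comp (measurable_const.add this)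
  rw [← setLIntegral_const, key _ measurable_const, key _ hm.enorm]
  refine setLIntegral_mono' measurableSet_Ioi fun r hr => ?_
  have hr : 0 < r := hr
  rw [lintegral_const_mul' _ _ ENNReal.ofReal_ne_top, lintegral_const_mul' _ _ ENNReal.ofReal_ne_top]
  gcongr 1
  have hmem : ∀ θ, c + Complex.polarCoord.symm (r, θ) ∈ Metric.ball c R ↔ r < R := by
    intro θ
    rw [mem_ball_iff_norm, add_sub_cancel_left, Complex.norm_polarCoord_symm, abs_of_pos hr]
  by_cases hrR : r < R
  · refine le_trans (le_of_eq ?_) ((circle_le h c R r hd hr hrR).trans (le_of_eq ?_))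
    · congr 1; ext θ; rw [Set.indicator_of_mem ((hmem θ).2 hrR)]
    · congr 1; ext θ; rw [Set.indicator_of_mem ((hmem θ).2 hrR)]
  · refine le_of_eq ?_
    congr 1; ext θ
    rw [Set.indicator_of_notMem (fun hh => hrR ((hmem θ).1 hh)), Set.indicator_of_notMem (fun hh => hrR ((hmem θ).1 hh))]

lemma area_mean_pow (h : ℂ → ℂ) (hm : Measurable h) (c : ℂ) (R : ℝ) (hR : 0 < R)
    (hd : DifferentiableOn ℂ h (Metric.ball c R)) :
    ‖h c‖ₑ ^ (4/3:ℝ) * volume (Metric.ball c R) ≤ ∫⁻ x in Metric.ball c R, ‖h x‖ₑ ^ (4/3:ℝ) := by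
  have hpq : (4/3:ℝ).HolderConjugate 4 := by
    rw [Real.holderConjugate_iff]; norm_num
  have h1 := area_mean h hm c R hd
  have h2 := ENNReal.lintegral_mul_le_Lp_mul_Lq (volume.restrict (Metric.ball c R)) hpq
    (f := fun x => ‖h x‖ₑ) (g := fun _ => 1) hm.enorm.aemeasurable aemeasurable_const
  simp only [Pi.mul_apply, mul_one, ENNReal.one_rpow, setLIntegral_one] at h2
  set V := volume (Metric.ball c R) with hV
  have hV0 : V ≠ 0 := (Metric.measure_ball_pos volume c hR).ne'
  have hVt : V ≠ ⊤ := measure_ball_lt_top.ne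
  set I := ∫⁻ x in Metric.ball c R, ‖h x‖ₑ ^ (4/3:ℝ) with hI
  have h3 := ENNReal.rpow_le_rpow (h1.trans h2) (by norm_num : (0:ℝ) ≤ 4/3)
  rw [ENNReal.mul_rpow_of_nonneg _ _ (by norm_num), ENNReal.mul_rpow_of_nonneg _ _ (by norm_num),
    ← ENNReal.rpow_mul, ← ENNReal.rpow_mul] at h3
  norm_num at h3
  have e1 : V ^ (4/3:ℝ) = V * V ^ (1/3:ℝ) := by
    have := ENNReal.rpow_add 1 (1/3:ℝ) hV0 hVt
    rw [ENNReal.rpow_one] at this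
    rw [← this]; norm_num
  rw [e1, ← mul_assoc] at h3
  have hc0 : V ^ (1/3:ℝ) ≠ 0 := by simp [hV0, hVt]
  have hct : V ^ (1/3:ℝ) ≠ ⊤ := by simp [hV0, hVt]
  exact (ENNReal.mul_le_mul_iff_left hc0 hct).1 h3

def mExp (α : ℝ) (z : ℂ) : ℕ := ⌊2 * α * logPlus ‖z‖⌋₊

def twist (α : ℝ) (f : ℂ → ℂ) (z w : ℂ) : ℂ := f w * (z / w) ^ (mExp α z)

def dens (α : ℝ) (f : ℂ → ℂ) (z : ℂ) : ℝ≥0∞ :=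
  ENNReal.ofReal ((‖f z‖ * Real.exp (-(phi α z))) ^ (4/3:ℝ))

lemma logPlus_nonneg (t : ℝ) : 0 ≤ logPlus t := le_max_right _ _

lemma phi_taylor (α : ℝ) (hα : 0 < α) (z w : ℂ) (h : |Real.log ‖w‖ - Real.log ‖z‖| ≤ 1) :
    phi α w ≤ phi α z + mExp α z * (Real.log ‖w‖ - Real.log ‖z‖) + (1 + α) := by
  set t := Real.log ‖z‖
  set u := Real.log ‖w‖
  have h1 : (max u 0)^2 ≤ (max t 0)^2 + 2 * max t 0 * (u - t) + (u-t)^2 := by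
    rcases le_total t 0 with ht | ht <;> rcases le_total u 0 with hu | hu <;>
      simp only [max_eq_left, max_eq_right, ht, hu] <;> nlinarith
  have h2 : (u-t)^2 ≤ 1 := by
    rw [← sq_abs]; nlinarith [abs_nonneg (u-t)]
  have h3 := Nat.floor_le (a := 2 * α * logPlus ‖z‖) (by have := logPlus_nonneg ‖z‖; positivity)
  have h4 := Nat.lt_floor_add_one (2 * α * logPlus ‖z‖)
  change (mExp α z : ℝ) ≤ _ at h3
  change _ < (mExp α z : ℝ) + 1 at h4
  have hz : phi α z = α * (max t 0)^2 := rfl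
  have hw : phi α w = α * (max u 0)^2 := rfl
  have hl : logPlus ‖z‖ = max t 0 := rfl
  rw [hl] at h3 h4
  rw [hz, hw]
  have h5 : (2 * α * max t 0 - mExp α z) * (u - t) ≤ 1 := by
    have := abs_le.1 h
    nlinarith
  nlinarith

lemma twist_weight (α : ℝ) (hα : 0 < α) (f : ℂ → ℂ) (z w : ℂ) (hz : z ≠ 0) 
    (h : ‖w - z‖ ≤ ‖z‖ / 2) :
    w ≠ 0 ∧ ‖twist α f z w‖ * Real.exp (-(phi α z)) ≤
      Real.exp (1 + α) * (‖f w‖ * Real.exp (-(phi α w))) := by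
  have hz0 : 0 < ‖z‖ := norm_pos_iff.2 hz
  have hw1 : ‖z‖ / 2 ≤ ‖w‖ := by
    have := norm_sub_norm_le z w
    rw [norm_sub_rev] at this; linarith
  have hw2 : ‖w‖ ≤ 2 * ‖z‖ := by
    have := norm_sub_norm_le w z
    linarith
  have hw0 : 0 < ‖w‖ := by linarith
  refine ⟨norm_pos_iff.1 hw0, ?_⟩
  have hl : |Real.log ‖w‖ - Real.log ‖z‖| ≤ 1 := by
    have l2 := Real.log_two_lt_d9
    have e1 := Real.log_le_log (by positivity) hw1
    have e2 := Real.log_le_log hw0 hw2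
    rw [Real.log_div hz0.ne' (by norm_num)] at e1
    rw [Real.log_mul (by norm_num) hz0.ne'] at e2
    rw [abs_le]; constructor <;> linarith
  have ht := phi_taylor α hα z w hl
  have e3 : ‖(z / w) ^ mExp α z‖ = Real.exp (-(mExp α z * (Real.log ‖w‖ - Real.log ‖z‖))) := by
    rw [norm_pow, norm_div, ← Real.exp_log (div_pos hz0 hw0), ← Real.exp_nat_mul,
      Real.log_div hz0.ne' hw0.ne']
    congr 1; ring
  rw [twist, norm_mul, e3, mul_assoc, ← Real.exp_add, mul_left_comm, ← Real.exp_add]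
  exact mul_le_mul_of_nonneg_left (Real.exp_le_exp.2 (by linarith)) (norm_nonneg _)

lemma local_est (α : ℝ) (hα : 0 < α) (c : ℝ) (hc : 0 < c) (hc2 : c ≤ 1/2) :
    ∃ C : ℝ, 0 < C ∧ ∀ f : ℂ → ℂ, Differentiable ℂ f → ∀ z : ℂ, z ≠ 0 → ∀ w : ℂ,
      ‖w - z‖ ≤ c / 2 * ‖z‖ →
      ENNReal.ofReal ((‖twist α f z w‖ * (‖z‖ ^ (3/2:ℝ) * Real.exp (-(phi α z)))) ^ (4/3:ℝ)) ≤
        ENNReal.ofReal C * ∫⁻ x in Metric.ball z (c * ‖z‖), dens α f x := by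
  refine ⟨Real.exp (1+α) ^ (4/3:ℝ) * (4 / (Real.pi * c^2)), by positivity, ?_⟩
  intro f hf z hz w hw
  have hz0 : 0 < ‖z‖ := norm_pos_iff.2 hz
  have hsub : Metric.ball w (c / 2 * ‖z‖) ⊆ Metric.ball z (c * ‖z‖) := by
    apply Metric.ball_subset_ball'
    rw [dist_eq_norm]; nlinarith
  have hsm : ∀ x ∈ Metric.ball z (c * ‖z‖), ‖x - z‖ ≤ ‖z‖/2 := by
    intro x hx
    rw [mem_ball_iff_norm] at hx
    nlinarith
  have hmeas : Measurable (twist α f z) := by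
    unfold twist
    have := hf.continuous.measurable
    fun_prop
  have hdiff : DifferentiableOn ℂ (twist α f z) (Metric.ball w (c / 2 * ‖z‖)) := by
    intro x hx
    have hx0 := (twist_weight α hα f z x hz (hsm x (hsub hx))).1
    apply DifferentiableAt.differentiableWithinAt
    unfold twist
    exact (hf x).mul (((differentiableAt_const z).div differentiableAt_id hx0).pow _)
  have h1 := area_mean_pow (twist α f z) hmeas w (c/2*‖z‖) (by positivity) hdiff
  set E := Real.exp (-(phi α z)) with hE
  have hE0 : 0 < E := Real.exp_pos _
  have h2 : ∀ x ∈ Metric.ball z (c * ‖z‖), ‖twist α f z x‖ₑ ^ (4/3:ℝ) * ENNReal.ofReal (E ^ (4/3:ℝ)) ≤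
      ENNReal.ofReal (Real.exp (1+α) ^ (4/3:ℝ)) * dens α f x := by
    intro x hx
    have hx0 := (twist_weight α hα f z x hz (hsm x hx)).2
    rw [← ofReal_norm, ENNReal.ofReal_rpow_of_nonneg (norm_nonneg _) (by norm_num),
      ← ENNReal.ofReal_mul (by positivity), ← Real.mul_rpow (norm_nonneg _) hE0.le, dens,
      ← ENNReal.ofReal_mul (by positivity), ← Real.mul_rpow (by positivity) (by positivity)]
    apply ENNReal.ofReal_le_ofReal
    exact Real.rpow_le_rpow (by positivity) hx0 (by norm_num)
  have h3 : ‖twist α f z w‖ₑ ^ (4/3:ℝ) * volume (Metric.ball w (c/2*‖z‖)) * ENNReal.ofReal (E ^ (4/3:ℝ)) ≤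
      ENNReal.ofReal (Real.exp (1+α) ^ (4/3:ℝ)) * ∫⁻ x in Metric.ball z (c * ‖z‖), dens α f x := by
    calc _ ≤ (∫⁻ x in Metric.ball w (c/2*‖z‖), ‖twist α f z x‖ₑ ^ (4/3:ℝ)) * ENNReal.ofReal (E ^ (4/3:ℝ)) := by
            gcongr
      _ ≤ (∫⁻ x in Metric.ball z (c*‖z‖), ‖twist α f z x‖ₑ ^ (4/3:ℝ)) * ENNReal.ofReal (E ^ (4/3:ℝ)) := by
            gcongr
      _ = ∫⁻ x in Metric.ball z (c*‖z‖), ‖twist α f z x‖ₑ ^ (4/3:ℝ) * ENNReal.ofReal (E ^ (4/3:ℝ)) := by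
            rw [lintegral_mul_const' _ _ ENNReal.ofReal_ne_top]
      _ ≤ ∫⁻ x in Metric.ball z (c*‖z‖), ENNReal.ofReal (Real.exp (1+α) ^ (4/3:ℝ)) * dens α f x :=
            setLIntegral_mono' Metric.isOpen_ball.measurableSet h2
      _ = _ := by rw [lintegral_const_mul' _ _ ENNReal.ofReal_ne_top]
  have hvol : volume (Metric.ball w (c/2*‖z‖)) = ENNReal.ofReal ((c/2*‖z‖)^2 * Real.pi) := by
    rw [Complex.volume_ball, ENNReal.ofReal_mul (p := (c/2*‖z‖)^2) (by positivity), ENNReal.ofReal_pow (by positivity)]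
    congr 1
    rw [← NNReal.coe_real_pi, ENNReal.ofReal_coe_nnreal]
  have e : (‖twist α f z w‖ * (‖z‖ ^ (3/2:ℝ) * E)) ^ (4/3:ℝ) =
      (4 / (Real.pi * c^2)) * (‖twist α f z w‖ ^ (4/3:ℝ) * ((c/2*‖z‖)^2 * Real.pi) * E ^ (4/3:ℝ)) := by
    rw [Real.mul_rpow (by positivity) (by positivity), Real.mul_rpow (by positivity) (by positivity),
      ← Real.rpow_mul (by positivity)]
    norm_num
    field_simp
    ring
  rw [e, mul_comm (Real.exp (1+α) ^ (4/3:ℝ)), ENNReal.ofReal_mul (p := 4 / (Real.pi * c^2)) (by positivity),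
    ENNReal.ofReal_mul (p := 4 / (Real.pi * c^2)) (by positivity), mul_assoc (ENNReal.ofReal (4 / (Real.pi * c^2)))]
  refine mul_le_mul' le_rfl ?_
  rw [hvol, ← ofReal_norm, ENNReal.ofReal_rpow_of_nonneg (norm_nonneg _) (by norm_num),
    ← ENNReal.ofReal_mul (by positivity), ← ENNReal.ofReal_mul (by positivity)] at h3
  exact h3

/-- the pointwise weight -/
def wt (α : ℝ) (z : ℂ) : ℝ := (1 + ‖z‖) ^ (3/2:ℝ) * Real.exp (-(phi α z))

/-- the pointwise weight without the regularisation at the origin -/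
def wt0 (α : ℝ) (z : ℂ) : ℝ := ‖z‖ ^ (3/2:ℝ) * Real.exp (-(phi α z))

lemma wt_pos (α : ℝ) (z : ℂ) : 0 < wt α z := by unfold wt; positivity

lemma wt0_pos (α : ℝ) (z : ℂ) (hz : z ≠ 0) : 0 < wt0 α z := by
  have := norm_pos_iff.2 hz
  unfold wt0; positivity

lemma wt0_le_wt (α : ℝ) (z : ℂ) : wt0 α z ≤ wt α z := by
  unfold wt0 wt
  gcongr
  linarith

lemma wt_le_wt0 (α : ℝ) (r : ℝ) (hr : 0 < r) (z : ℂ) (hz : r ≤ ‖z‖) :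
    wt α z ≤ (1 + 1/r) ^ (3/2:ℝ) * wt0 α z := by
  unfold wt0 wt
  rw [← mul_assoc, ← Real.mul_rpow (by positivity) (norm_nonneg _)]
  gcongr
  have : 1 ≤ 1 / r * ‖z‖ := by rw [div_mul_eq_mul_div, one_mul]; exact (one_le_div hr).2 hz
  linarith

lemma term_eq (α : ℝ) (z : ℂ) (x : ℝ) (hx : 0 ≤ x) :
    (1 + ‖z‖) ^ 2 * x ^ (4/3:ℝ) * Real.exp (-(4/3 * phi α z)) = (x * wt α z) ^ (4/3:ℝ) := by
  unfold wt
  rw [Real.mul_rpow hx (by positivity), Real.mul_rpow (by positivity) (by positivity),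
    ← Real.rpow_mul (by positivity), ← Real.exp_mul]
  norm_num
  ring_nf

lemma disc_range (α : ℝ) (μ : ℕ → ℂ) (hinj : Function.Injective μ) (v : ℂ → ℂ) :
    (∑' lam : Set.range μ, ENNReal.ofReal
      ((1 + ‖(lam : ℂ)‖) ^ 2 * ‖v (lam : ℂ)‖ ^ (4/3:ℝ) *
        Real.exp (-(4/3 * phi α (lam : ℂ))))) =
      ∑' k, ENNReal.ofReal ((‖v (μ k)‖ * wt α (μ k)) ^ (4/3:ℝ)) := by
  rw [tsum_range (f := fun z : ℂ => ENNReal.ofReal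
      ((1 + ‖z‖) ^ 2 * ‖v z‖ ^ (4/3:ℝ) * Real.exp (-(4/3 * phi α z)))) hinj]
  congr 1; ext k
  rw [term_eq _ _ _ (norm_nonneg _)]

lemma rpow43_le {x y : ℝ} (hx : 0 ≤ x) (hy : 0 ≤ y) : x ^ (4/3:ℝ) ≤ y ^ (4/3:ℝ) ↔ x ≤ y :=
  Real.rpow_le_rpow_iff hx hy (by norm_num)

lemma rpow43_34 {x : ℝ} (hx : 0 ≤ x) : (x ^ (3/4:ℝ)) ^ (4/3:ℝ) = x := by
  rw [← Real.rpow_mul hx]; norm_num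

lemma fock_eq (α : ℝ) (f : ℂ → ℂ) : fockNormP α (4/3) f = ∫⁻ x, dens α f x := rfl

/-- uniform local bound by the Fock norm -/
lemma twist_bound (α : ℝ) (hα : 0 < α) : ∃ C : ℝ, 0 < C ∧ ∀ f : ℂ → ℂ, Differentiable ℂ f →
    ∀ B : ℝ, 0 ≤ B → fockNormP α (4/3) f ≤ ENNReal.ofReal (B ^ (4/3:ℝ)) →
    ∀ z : ℂ, z ≠ 0 → ∀ w : ℂ, ‖w - z‖ ≤ 1/4 * ‖z‖ → ‖twist α f z w‖ * wt0 α z ≤ C * B := by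
  obtain ⟨C, hC, h⟩ := local_est α hα (1/2) (by norm_num) le_rfl
  refine ⟨C ^ (3/4:ℝ), by positivity, ?_⟩
  intro f hf B hB hfB z hz w hw
  have h1 := h f hf z hz w (by linarith)
  have h2 : ∫⁻ x in Metric.ball z (1/2 * ‖z‖), dens α f x ≤ ENNReal.ofReal (B ^ (4/3:ℝ)) :=
    (setLIntegral_le_lintegral _ _).trans hfB
  have h3 := h1.trans (mul_le_mul' le_rfl h2)
  rw [← ENNReal.ofReal_mul hC.le, ENNReal.ofReal_le_ofReal_iff (by positivity)] at h3
  nth_rw 1 [← rpow43_34 hC.le] at h3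
  rw [← Real.mul_rpow (by positivity) hB] at h3
  exact (rpow43_le (by have := wt0_pos α z hz; unfold wt0 at *; positivity) (by positivity)).1 h3

lemma twist_self (α : ℝ) (f : ℂ → ℂ) (z : ℂ) (hz : z ≠ 0) : twist α f z z = f z := by
  simp [twist, hz]

lemma pointwise_bound (α : ℝ) (hα : 0 < α) (f : ℂ → ℂ) (hf : MemFock α (4/3) f) :
    ∃ K : ℝ, 0 < K ∧ ∀ z, z ≠ 0 → ‖f z‖ * wt0 α z ≤ K := by
  obtain ⟨C, hC, h⟩ := twist_bound α hα
  set B := (fockNormP α (4/3) f).toReal ^ (3/4:ℝ)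
  have hB : 0 ≤ B := by positivity
  refine ⟨C * B + 1, by positivity, fun z hz => ?_⟩
  have := h f hf.1 B hB (by
    rw [rpow43_34 ENNReal.toReal_nonneg, ENNReal.ofReal_toReal hf.2.ne]) z hz z (by simp)
  rw [twist_self α f z hz] at this
  linarith

def SepSeq (c : ℝ) (μ : ℕ → ℂ) : Prop := ∀ i k, i ≠ k → c * ‖μ k‖ ≤ ‖μ i - μ k‖

lemma sum_balls (α : ℝ) (f : ℂ → ℂ) (c : ℝ) (hc : 0 < c) (μ : ℕ → ℂ) (hs : SepSeq c μ) :
    ∑' k, ∫⁻ x in Metric.ball (μ k) (c / 2 * ‖μ k‖), dens α f x ≤ fockNormP α (4/3) f := by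
  rw [← lintegral_iUnion (fun _ => Metric.isOpen_ball.measurableSet), fock_eq]
  · exact setLIntegral_le_lintegral _ _
  · intro i k hik
    apply Metric.ball_disjoint_ball
    rw [dist_eq_norm]
    have h1 := hs i k hik
    have h2 := hs k i hik.symm
    rw [norm_sub_rev] at h2
    linarith

lemma pp_value (α : ℝ) (hα : 0 < α) (c : ℝ) (hc : 0 < c) (hc2 : c ≤ 1) (r : ℝ) (hr : 0 < r) :
    ∃ C : ℝ, 0 < C ∧ ∀ f : ℂ → ℂ, Differentiable ℂ f → ∀ μ : ℕ → ℂ, SepSeq c μ → (∀ k, r ≤ ‖μ k‖) →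
      ∑' k, ENNReal.ofReal ((‖f (μ k)‖ * wt α (μ k)) ^ (4/3:ℝ)) ≤
        ENNReal.ofReal C * fockNormP α (4/3) f := by
  obtain ⟨C, hC, h⟩ := local_est α hα (c/2) (by positivity) (by linarith)
  refine ⟨((1 + 1/r) ^ (3/2:ℝ)) ^ (4/3:ℝ) * C, by positivity, ?_⟩
  intro f hf μ hs hμ
  refine le_trans ?_ (mul_le_mul' le_rfl (sum_balls α f c hc μ hs))
  rw [← ENNReal.tsum_mul_left]
  refine ENNReal.tsum_le_tsum fun k => ?_
  have hk : μ k ≠ 0 := norm_pos_iff.1 (hr.trans_le (hμ k))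
  have h1 := h f hf (μ k) hk (μ k) (by simp; positivity)
  rw [twist_self α f _ hk] at h1
  rw [ENNReal.ofReal_mul (by positivity), mul_assoc]
  refine le_trans ?_ (mul_le_mul' le_rfl h1)
  rw [← ENNReal.ofReal_mul (by positivity), ← Real.mul_rpow (by positivity) (by positivity)]
  apply ENNReal.ofReal_le_ofReal
  refine Real.rpow_le_rpow (by have := wt_pos α (μ k); positivity) ?_ (by norm_num)
  have := wt_le_wt0 α r hr (μ k) (hμ k)
  rw [mul_left_comm]
  exact mul_le_mul_of_nonneg_left this (norm_nonneg _)

lemma deriv_local (α : ℝ) (hα : 0 < α) (c : ℝ) (hc : 0 < c) (hc2 : c ≤ 1/2) :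
    ∃ C : ℝ, 0 < C ∧ ∀ f : ℂ → ℂ, Differentiable ℂ f → ∀ z : ℂ, z ≠ 0 → f z = 0 →
      ENNReal.ofReal ((‖deriv f z‖ * ‖z‖ * wt0 α z) ^ (4/3:ℝ)) ≤
        ENNReal.ofReal C * ∫⁻ x in Metric.ball z (c * ‖z‖), dens α f x := by
  obtain ⟨C, hC, h⟩ := local_est α hα c hc hc2
  refine ⟨(2/c) ^ (4/3:ℝ) * C, by positivity, ?_⟩
  intro f hf z hz hfz
  have hz0 := norm_pos_iff.2 hz
  have hw0 := wt0_pos α z hz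
  set I := ∫⁻ x in Metric.ball z (c * ‖z‖), dens α f x with hI
  by_cases hIt : I = ⊤
  · rw [hIt, ENNReal.mul_top]
    · exact le_top
    · simp only [ne_eq, ENNReal.ofReal_eq_zero, not_le]; positivity
  set J := I.toReal with hJ
  have hJ0 : 0 ≤ J := ENNReal.toReal_nonneg
  have hIJ : I = ENNReal.ofReal J := (ENNReal.ofReal_toReal hIt).symm
  have hb : ∀ w, ‖w - z‖ ≤ c / 2 * ‖z‖ → ‖twist α f z w‖ ≤ (C * J) ^ (3/4:ℝ) / wt0 α z := by
    intro w hw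
    have h1 := h f hf z hz w hw
    rw [← hI, hIJ, ← ENNReal.ofReal_mul hC.le, ENNReal.ofReal_le_ofReal_iff (by positivity),
      ← rpow43_34 (x := C * J) (by positivity)] at h1
    rw [le_div_iff₀ hw0]
    exact (rpow43_le (by positivity) (by positivity)).1 h1
  have hd : DiffContOnCl ℂ (twist α f z) (Metric.ball z (c / 2 * ‖z‖)) := by
    apply DifferentiableOn.diffContOnCl
    rw [closure_ball _ (by positivity)]
    intro x hx
    rw [mem_closedBall_iff_norm] at hx
    have hx0 := (twist_weight α hα f z x hz (by nlinarith)).1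
    apply DifferentiableAt.differentiableWithinAt
    unfold twist
    exact (hf x).mul (((differentiableAt_const z).div differentiableAt_id hx0).pow _)
  have h2 := Complex.norm_deriv_le_of_forall_mem_sphere_norm_le (by positivity) hd
    (fun w hw => hb w (by rw [mem_sphere_iff_norm] at hw; exact hw.le))
  have h3 : deriv (twist α f z) z = deriv f z := by
    have hg : DifferentiableAt ℂ (fun w => (z / w) ^ mExp α z) z :=
      (((differentiableAt_const z).div differentiableAt_id hz).pow _)
    have : deriv (twist α f z) z = deriv f z * (z / z) ^ mExp α z + f z * deriv (fun w => (z / w) ^ mExp α z) z :=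
      deriv_fun_mul (hf z) hg
    rw [this, hfz, div_self hz]; simp
  rw [h3] at h2
  rw [hIJ, ← ENNReal.ofReal_mul (by positivity)]
  apply ENNReal.ofReal_le_ofReal
  rw [mul_assoc _ C J, ← rpow43_34 (x := C * J) (by positivity), ← Real.mul_rpow (by positivity) (by positivity)]
  refine Real.rpow_le_rpow (by positivity) ?_ (by norm_num)
  calc _ ≤ (C * J) ^ (3/4:ℝ) / wt0 α z / (c/2 * ‖z‖) * ‖z‖ * wt0 α z := by gcongr
    _ = _ := by field_simp

lemma pp_deriv (α : ℝ) (hα : 0 < α) (c : ℝ) (hc : 0 < c) (hc2 : c ≤ 1) :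
    ∃ C : ℝ, 0 < C ∧ ∀ f : ℂ → ℂ, Differentiable ℂ f → ∀ μ : ℕ → ℂ, SepSeq c μ → (∀ k, μ k ≠ 0) →
      ∀ s : Finset ℕ, (∀ k ∈ s, f (μ k) = 0) →
      ∑ k ∈ s, ENNReal.ofReal ((‖deriv f (μ k)‖ * ‖μ k‖ * wt0 α (μ k)) ^ (4/3:ℝ)) ≤
        ENNReal.ofReal C * fockNormP α (4/3) f := by
  obtain ⟨C, hC, h⟩ := deriv_local α hα (c/2) (by positivity) (by linarith)
  refine ⟨C, hC, ?_⟩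
  intro f hf μ hs hμ s hfs
  refine le_trans ?_ (mul_le_mul' le_rfl (sum_balls α f c hc μ hs))
  rw [← ENNReal.tsum_mul_left]
  refine le_trans ?_ (ENNReal.sum_le_tsum s)
  exact Finset.sum_le_sum fun k hk => h f hf (μ k) (hμ k) (hfs k hk)

/-- membership comparison -/
lemma memFock_of_le (α : ℝ) (hα : 0 < α) (f g : ℂ → ℂ) (hf : Differentiable ℂ f) (hg : MemFock α (4/3) g)
    (C R : ℝ) (hC : 0 ≤ C) (h : ∀ z, R ≤ ‖z‖ → ‖f z‖ ≤ C * ‖g z‖) : MemFock α (4/3) f := by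
  refine ⟨hf, ?_⟩
  obtain ⟨M, hM⟩ := (isCompact_closedBall (0:ℂ) R).exists_bound_of_continuousOn hf.continuous.continuousOn
  rw [fock_eq]
  have hb : ∀ z, dens α f z ≤ (Metric.closedBall (0:ℂ) R).indicator (fun _ => ENNReal.ofReal (|M| ^ (4/3:ℝ))) z
      + ENNReal.ofReal (C ^ (4/3:ℝ)) * dens α g z := by
    intro z
    by_cases hz : ‖z‖ ≤ R
    · refine le_trans ?_ le_self_add
      rw [Set.indicator_of_mem (by simpa using hz)]
      apply ENNReal.ofReal_le_ofReal
      refine Real.rpow_le_rpow (by positivity) ?_ (by norm_num)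
      have h1 := hM z (by simpa using hz)
      have h2 : Real.exp (-(phi α z)) ≤ 1 := by
        rw [Real.exp_le_one_iff]; unfold phi; have := sq_nonneg (logPlus ‖z‖); nlinarith
      have h3 : ‖f z‖ ≤ |M| := h1.trans (le_abs_self _)
      calc _ ≤ |M| * 1 := by gcongr
        _ = _ := mul_one _
    · refine le_trans ?_ le_add_self
      rw [dens, dens, ← ENNReal.ofReal_mul (by positivity), ← Real.mul_rpow hC (by positivity)]
      apply ENNReal.ofReal_le_ofReal
      refine Real.rpow_le_rpow (by positivity) ?_ (by norm_num)
      rw [← mul_assoc]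
      gcongr
      exact h z (by linarith)
  refine (lintegral_mono hb).trans_lt ?_
  rw [lintegral_add_left (measurable_const.indicator Metric.isClosed_closedBall.measurableSet),
    lintegral_indicator Metric.isClosed_closedBall.measurableSet, setLIntegral_const,
    lintegral_const_mul' _ _ ENNReal.ofReal_ne_top]
  refine ENNReal.add_lt_top.2 ⟨ENNReal.mul_lt_top ENNReal.ofReal_lt_top ?_, ENNReal.mul_lt_top ENNReal.ofReal_lt_top hg.2⟩
  exact measure_closedBall_lt_top

lemma geo_sum_inj (r : ℝ) (h0 : 0 ≤ r) (h1 : r < 1) (F : Finset ℕ) (m : ℕ → ℕ)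
    (hm : Set.InjOn m F) : ∑ i ∈ F, r ^ (m i) ≤ 1 / (1 - r) := by
  rw [← Finset.sum_image (f := fun i => r ^ i) hm, one_div, ← tsum_geometric_of_lt_one h0 h1]
  exact (summable_geometric_of_lt_one h0 h1).sum_le_tsum _ (fun i _ => by positivity)

lemma geo_sum (κ : ℝ) (hκ : 0 < κ) : ∃ A : ℝ, 0 < A ∧ ∀ (F : Finset ℕ) (k : ℕ),
    ∑ i ∈ F, Real.exp (-(κ * |(i:ℝ) - k|)) ≤ A := by
  set r := Real.exp (-κ) with hr
  have h0 : 0 < r := Real.exp_pos _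
  have h1 : r < 1 := by rw [hr, Real.exp_lt_one_iff]; linarith
  have h2 : 0 < 1 / (1 - r) := by apply div_pos one_pos; linarith
  refine ⟨2 * (1 / (1 - r)), by positivity, fun F k => ?_⟩
  rw [← Finset.sum_filter_add_sum_filter_not F (fun i => i < k), two_mul]
  apply add_le_add
  · refine le_trans (le_of_eq ?_) (geo_sum_inj r h0.le h1 (F.filter (fun i => i < k)) (fun i => k - i) ?_)
    · refine Finset.sum_congr rfl fun i hi => ?_
      have hik := (Finset.mem_filter.1 hi).2
      have : (i:ℝ) < k := by exact_mod_cast hik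
      rw [hr, ← Real.exp_nat_mul, Nat.cast_sub hik.le, abs_of_neg (by linarith)]
      congr 1; ring
    · intro a ha b hb hab
      have ha' := (Finset.mem_filter.1 ha).2
      have hb' := (Finset.mem_filter.1 hb).2
      simp only at hab
      omega
  · refine le_trans (le_of_eq ?_) (geo_sum_inj r h0.le h1 (F.filter (fun i => ¬ i < k)) (fun i => i - k) ?_)
    · refine Finset.sum_congr rfl fun i hi => ?_
      have hik := not_lt.1 (Finset.mem_filter.1 hi).2
      have : (k:ℝ) ≤ i := by exact_mod_cast hik
      rw [hr, ← Real.exp_nat_mul, Nat.cast_sub hik, abs_of_nonneg (by linarith)]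
      congr 1; ring
    · intro a ha b hb hab
      have ha' := (Finset.mem_filter.1 ha).2
      have hb' := (Finset.mem_filter.1 hb).2
      simp only at hab
      omega

/-- `z` sits at level `j` relative to the points `μ i`, `i ∈ F`. -/
def Lev (κ B : ℝ) (μ : ℕ → ℂ) (F : Finset ℕ) (j : ℕ) (z : ℂ) : Prop :=
  ∀ i ∈ F, (i < j → ‖μ i‖ ≤ Real.exp (B - κ * |(i:ℝ) - j|) * ‖z‖) ∧
    (j ≤ i → ‖z‖ ≤ Real.exp (B - κ * |(i:ℝ) - j|) * ‖μ i‖)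

lemma sum_expB (κ : ℝ) (hκ : 0 < κ) (B : ℝ) : ∃ A : ℝ, 0 < A ∧ ∀ (F : Finset ℕ) (k : ℕ),
    ∑ i ∈ F, Real.exp (B - κ * |(i:ℝ) - k|) ≤ A := by
  obtain ⟨A, hA, h⟩ := geo_sum κ hκ
  refine ⟨Real.exp B * A, by positivity, fun F k => ?_⟩
  refine le_trans (le_of_eq ?_) (mul_le_mul_of_nonneg_left (h F k) (Real.exp_pos B).le)
  rw [Finset.mul_sum]
  refine Finset.sum_congr rfl fun i _ => ?_
  rw [← Real.exp_add]; congr 1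

lemma prod_upper (κ : ℝ) (hκ : 0 < κ) (B : ℝ) : ∃ A : ℝ, 0 < A ∧ ∀ (μ : ℕ → ℂ) (F : Finset ℕ) (j : ℕ) (z : ℂ),
    (∀ i, μ i ≠ 0) → Lev κ B μ F j z →
    ∏ i ∈ F, ‖1 - z / μ i‖ ≤ A * ∏ i ∈ F.filter (fun i => i < j), (‖z‖ / ‖μ i‖) := by
  obtain ⟨A, hA, h⟩ := sum_expB κ hκ B
  refine ⟨Real.exp A, Real.exp_pos _, ?_⟩
  intro μ F j z hμ hL
  have hterm : ∀ i ∈ F, ‖1 - z / μ i‖ ≤ Real.exp (Real.exp (B - κ * |(i:ℝ) - j|)) *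
      (if i < j then ‖z‖ / ‖μ i‖ else 1) := by
    intro i hi
    have hμi := norm_pos_iff.2 (hμ i)
    have h1 : ‖1 - z / μ i‖ ≤ 1 + ‖z‖ / ‖μ i‖ := by
      refine (norm_sub_le _ _).trans_eq ?_
      rw [norm_one, norm_div]
    split_ifs with hij
    · have h2 := (hL i hi).1 hij
      set x := Real.exp (B - κ * |(i:ℝ) - j|)
      have h3 := Real.add_one_le_exp x
      refine h1.trans ?_
      have h4 : 1 ≤ x * (‖z‖ / ‖μ i‖) := by
        rw [← mul_div_assoc, le_div_iff₀ hμi]; linarith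
      have : 0 ≤ ‖z‖ / ‖μ i‖ := by positivity
      nlinarith
    · have h2 := (hL i hi).2 (not_lt.1 hij)
      set x := Real.exp (B - κ * |(i:ℝ) - j|)
      have h3 := Real.add_one_le_exp x
      have h4 : ‖z‖ / ‖μ i‖ ≤ x := by rw [div_le_iff₀ hμi]; linarith
      linarith
  calc _ ≤ ∏ i ∈ F, Real.exp (Real.exp (B - κ * |(i:ℝ) - j|)) * (if i < j then ‖z‖ / ‖μ i‖ else 1) :=
        Finset.prod_le_prod (fun _ _ => norm_nonneg _) hterm
    _ = Real.exp (∑ i ∈ F, Real.exp (B - κ * |(i:ℝ) - j|)) * ∏ i ∈ F.filter (fun i => i < j), (‖z‖ / ‖μ i‖) := by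
        rw [Finset.prod_mul_distrib, Real.exp_sum, Finset.prod_filter]
    _ ≤ _ := by
        gcongr
        exact h F j

lemma one_sub_lower (c : ℝ) (hc : 0 < c) (hc1 : c ≤ 1) (w : ℂ) (x : ℝ) (hw : ‖w‖ ≤ x) (h : c ≤ ‖1 - w‖) :
    Real.exp (-((2 + 2 * Real.log (1/c)) * x)) ≤ ‖1 - w‖ := by
  have hl : 0 ≤ Real.log (1/c) := Real.log_nonneg (by rw [le_div_iff₀ hc]; linarith)
  have hx0 : 0 ≤ x := (norm_nonneg _).trans hw
  by_cases hx : x ≤ 1/2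
  · have h1 : 1 - x ≤ ‖1 - w‖ := by
      have := norm_sub_norm_le (1:ℂ) w
      rw [norm_one] at this; linarith
    refine le_trans ?_ h1
    have h2 : Real.exp (-((2 + 2 * Real.log (1/c)) * x)) ≤ Real.exp (-(2*x)) := by
      apply Real.exp_le_exp.2; nlinarith [mul_nonneg hl hx0]
    refine h2.trans ?_
    rw [Real.exp_neg]
    have h3 := Real.add_one_le_exp (2*x)
    rw [inv_le_comm₀ (Real.exp_pos _) (by linarith)]
    refine le_trans ?_ h3
    rw [inv_le_iff_one_le_mul₀ (by linarith)]
    nlinarith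
  · refine le_trans ?_ h
    have : c = Real.exp (-(Real.log (1/c))) := by
      rw [one_div, Real.log_inv, neg_neg, Real.exp_log hc]
    nth_rw 2 [this]
    apply Real.exp_le_exp.2
    push Not at hx
    nlinarith

lemma prod_lower (κ : ℝ) (hκ : 0 < κ) (B : ℝ) (c : ℝ) (hc : 0 < c) (hc1 : c ≤ 1) :
    ∃ A : ℝ, 0 < A ∧ ∀ (μ : ℕ → ℂ) (F : Finset ℕ) (j : ℕ) (z : ℂ),
    (∀ i, μ i ≠ 0) → z ≠ 0 → Lev κ B μ F j z → (∀ i ∈ F, c * ‖z‖ ≤ ‖μ i - z‖ ∧ c * ‖μ i‖ ≤ ‖μ i - z‖) →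
    A * ∏ i ∈ F.filter (fun i => i < j), (‖z‖ / ‖μ i‖) ≤ ∏ i ∈ F, ‖1 - z / μ i‖ := by
  obtain ⟨A, hA, h⟩ := sum_expB κ hκ B
  set L := 2 + 2 * Real.log (1/c) with hLdef
  have hL0 : 0 ≤ L := by
    have hl : 0 ≤ Real.log (1/c) := Real.log_nonneg (by rw [le_div_iff₀ hc]; linarith)
    positivity
  refine ⟨Real.exp (-(L * A)), Real.exp_pos _, ?_⟩
  intro μ F j z hμ hz hL hsep
  have hz0 := norm_pos_iff.2 hz
  have hterm : ∀ i ∈ F, Real.exp (-(L * Real.exp (B - κ * |(i:ℝ) - j|))) *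
      (if i < j then ‖z‖ / ‖μ i‖ else 1) ≤ ‖1 - z / μ i‖ := by
    intro i hi
    have hμi := norm_pos_iff.2 (hμ i)
    split_ifs with hij
    · have h2 := (hL i hi).1 hij
      have e : 1 - z / μ i = (1 - μ i / z) * (-(z / μ i)) := by
        have := hμ i
        field_simp; ring
      rw [e, norm_mul, norm_neg, norm_div z]
      gcongr
      apply one_sub_lower c hc hc1
      · rw [norm_div, div_le_iff₀ hz0]; exact h2
      · have e2 : 1 - μ i / z = -((μ i - z) / z) := by field_simp; ring
        rw [e2, norm_neg, norm_div, le_div_iff₀ hz0]; exact (hsep i hi).1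
    · have h2 := (hL i hi).2 (not_lt.1 hij)
      rw [mul_one]
      apply one_sub_lower c hc hc1
      · rw [norm_div, div_le_iff₀ hμi]; exact h2
      · have e2 : 1 - z / μ i = (μ i - z) / μ i := by have := hμ i; field_simp
        rw [e2, norm_div, le_div_iff₀ hμi]; exact (hsep i hi).2
  calc _ ≤ Real.exp (∑ i ∈ F, -(L * Real.exp (B - κ * |(i:ℝ) - j|))) * ∏ i ∈ F.filter (fun i => i < j), (‖z‖ / ‖μ i‖) := by
        gcongr
        rw [Finset.sum_neg_distrib, ← Finset.mul_sum]
        have := mul_le_mul_of_nonneg_left (h F j) hL0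
        linarith
    _ = ∏ i ∈ F, Real.exp (-(L * Real.exp (B - κ * |(i:ℝ) - j|))) * (if i < j then ‖z‖ / ‖μ i‖ else 1) := by
        rw [Finset.prod_mul_distrib, Real.exp_sum, Finset.prod_filter]
    _ ≤ _ := Finset.prod_le_prod (fun i _ => by split_ifs <;> positivity) hterm

lemma dslope_diff (f : ℂ → ℂ) (hf : Differentiable ℂ f) (a : ℂ) : Differentiable ℂ (dslope f a) := by
  rw [← differentiableOn_univ] at hf ⊢
  exact (Complex.differentiableOn_dslope Filter.univ_mem).2 hf

lemma dslope_mul (f : ℂ → ℂ) (a : ℂ) (ha : f a = 0) (z : ℂ) : f z = (z - a) * dslope f a z := by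
  have := sub_smul_dslope f a z
  rw [smul_eq_mul, ha, sub_zero] at this
  exact this.symm

lemma div_finset (f : ℂ → ℂ) (hf : Differentiable ℂ f) (μ : ℕ → ℂ) (hinj : Function.Injective μ)
    (hμ : ∀ i, μ i ≠ 0) (F : Finset ℕ) (h0 : ∀ i ∈ F, f (μ i) = 0) :
    ∃ h : ℂ → ℂ, Differentiable ℂ h ∧ ∀ z, f z = (∏ i ∈ F, (1 - z / μ i)) * h z := by
  induction F using Finset.induction_on with
  | empty => exact ⟨f, hf, by simp⟩
  | insert a F ha ih =>
    obtain ⟨h, hh, e⟩ := ih (fun i hi => h0 i (Finset.mem_insert_of_mem hi))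
    have hza : h (μ a) = 0 := by
      have h1 := e (μ a)
      rw [h0 a (Finset.mem_insert_self _ _)] at h1
      rcases mul_eq_zero.1 h1.symm with h2 | h2
      · exfalso
        obtain ⟨i, hi, hi2⟩ := Finset.prod_eq_zero_iff.1 h2
        have : μ a = μ i := by
          have := sub_eq_zero.1 hi2
          rw [eq_div_iff (hμ i), one_mul] at this
          exact this.symm
        exact ha (hinj this ▸ hi)
      · exact h2
    refine ⟨fun z => -(μ a) * dslope h (μ a) z, (dslope_diff h hh _).const_mul _, fun z => ?_⟩
    rw [e z, Finset.prod_insert ha, dslope_mul h (μ a) hza z]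
    have := hμ a
    field_simp
    ring

def Grow (κ B : ℝ) (μ : ℕ → ℂ) : Prop := ∀ j k, j ≤ k →
  ‖μ j‖ ≤ Real.exp (B - κ * ((k:ℝ) - j)) * ‖μ k‖

lemma Grow.lev {κ B : ℝ} {μ : ℕ → ℂ} (h : Grow κ B μ) (F : Finset ℕ) (k : ℕ) : Lev κ B μ F k (μ k) := by
  intro i _
  constructor
  · intro hik
    have := h i k hik.le
    have h' : (i:ℝ) < k := by exact_mod_cast hik
    rwa [abs_of_neg (by linarith), neg_sub]
  · intro hik
    have := h k i hik
    have h' : (k:ℝ) ≤ i := by exact_mod_cast hik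
    rwa [abs_of_nonneg (by linarith)]

lemma Grow.lev_zero {κ B : ℝ} {μ : ℕ → ℂ} (h : Grow κ B μ) (hμ : ∀ i, μ i ≠ 0) (z : ℂ) : 
    ∃ B' : ℝ, ∀ F, Lev κ B' μ F 0 z := by
  have h0 := norm_pos_iff.2 (hμ 0)
  refine ⟨B + ‖z‖ / ‖μ 0‖, fun F i _ => ⟨fun hi => absurd hi (Nat.not_lt_zero _), fun _ => ?_⟩⟩
  have h1 := h 0 i (Nat.zero_le _)
  have h2 := Real.add_one_le_exp (‖z‖ / ‖μ 0‖)
  have h3 : ‖z‖ ≤ Real.exp (‖z‖ / ‖μ 0‖) * ‖μ 0‖ := by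
    have : ‖z‖ = ‖z‖ / ‖μ 0‖ * ‖μ 0‖ := by field_simp
    nth_rw 1 [this]
    gcongr; linarith
  refine h3.trans ((mul_le_mul_of_nonneg_left h1 (Real.exp_pos _).le).trans_eq ?_)
  rw [← mul_assoc, ← Real.exp_add]
  congr 2
  have : (0:ℝ) ≤ i := Nat.cast_nonneg i
  push_cast
  rw [sub_zero, abs_of_nonneg this]; ring

lemma wt0_norm (α : ℝ) (z w : ℂ) (h : ‖z‖ = ‖w‖) : wt0 α z = wt0 α w := by
  unfold wt0 phi; rw [h]

lemma max_circle (h : ℂ → ℂ) (hh : Differentiable ℂ h) (R C : ℝ) (hR : 0 < R)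
    (hb : ∀ w, ‖w‖ = R → ‖h w‖ ≤ C) (z : ℂ) (hz : ‖z‖ ≤ R) : ‖h z‖ ≤ C := by
  apply Complex.norm_le_of_forall_mem_frontier_norm_le (U := Metric.ball (0:ℂ) R) Metric.isBounded_ball
    hh.diffContOnCl
  · intro w hw
    rw [frontier_ball _ hR.ne', mem_sphere_zero_iff_norm] at hw
    exact hb w hw
  · rw [closure_ball _ hR.ne']; simpa using hz

/-- abstract uniqueness -/
lemma uniqueness (α : ℝ) (κ B : ℝ) (hκ : 0 < κ) (μ : ℕ → ℂ) (hinj : Function.Injective μ)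
    (hμ : ∀ i, μ i ≠ 0) (hmono : ∀ i j, i ≤ j → ‖μ i‖ ≤ ‖μ j‖) (hG : Grow κ B μ)
    (hQ : Filter.Tendsto (fun n => (∏ i ∈ Finset.range n, (2 * ‖μ n‖ / ‖μ i‖)) * wt0 α (2 * μ n))
      Filter.atTop Filter.atTop)
    (hinf : Filter.Tendsto (fun n => ‖μ n‖) Filter.atTop Filter.atTop)
    (f : ℂ → ℂ) (hf : Differentiable ℂ f) (K : ℝ) (hK : 0 < K) (hfK : ∀ z, z ≠ 0 → ‖f z‖ * wt0 α z ≤ K)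
    (h0 : ∀ i, f (μ i) = 0) : f = 0 := by
  obtain ⟨A, hA, hlow⟩ := prod_lower κ hκ B (1/2) (by norm_num) (by norm_num)
  funext z
  obtain ⟨B', hB'⟩ := hG.lev_zero hμ z
  obtain ⟨A', hA', hup⟩ := prod_upper κ hκ B'
  set Q : ℕ → ℝ := fun n => (∏ i ∈ Finset.range n, (2 * ‖μ n‖ / ‖μ i‖)) * wt0 α (2 * μ n) with hQdef
  have key : ∀ᶠ n in Filter.atTop, ‖f z‖ ≤ A' * (K / A) * (Q n)⁻¹ := by
    filter_upwards [hinf.eventually_ge_atTop ‖z‖] with n hn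
    have hn0 := norm_pos_iff.2 (hμ n)
    obtain ⟨h, hh, e⟩ := div_finset f hf μ hinj hμ (Finset.range n) (fun i _ => h0 i)
    have hQn : 0 < Q n := by
      refine mul_pos (Finset.prod_pos fun i _ => ?_) (wt0_pos _ _ ?_)
      · have := norm_pos_iff.2 (hμ i); positivity
      · simpa using hμ n
    have hb : ∀ w, ‖w‖ = 2 * ‖μ n‖ → ‖h w‖ ≤ (K / A) * (Q n)⁻¹ := by
      intro w hw
      have hw0 : w ≠ 0 := norm_pos_iff.1 (by rw [hw]; positivity)
      have h1 := hlow μ (Finset.range n) n w hμ hw0 (by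
        intro i hi
        have hi' := Finset.mem_range.1 hi
        refine ⟨fun _ => ?_, fun hni => absurd hni (not_le.2 hi')⟩
        refine ((hG.lev (Finset.range n) n i hi).1 hi').trans ?_
        gcongr; rw [hw]; linarith) (by
        intro i hi
        have hi' := hmono i n (Finset.mem_range.1 hi).le
        have h2 := norm_sub_norm_le w (μ i)
        rw [norm_sub_rev] at h2
        constructor <;> linarith)
      have hfil : (Finset.range n).filter (fun i => i < n) = Finset.range n := by
        apply Finset.filter_true_of_mem; intro i hi; exact Finset.mem_range.1 hi
      rw [hfil, hw] at h1
      have h2 := hfK w hw0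
      rw [wt0_norm α w (2 * μ n) (by rw [hw]; simp), e w, norm_mul, norm_prod] at h2
      have hw2 : 0 < wt0 α (2 * μ n) := wt0_pos _ _ (by simpa using hμ n)
      have h3 : A * Q n * ‖h w‖ ≤ K := by
        refine le_trans ?_ h2
        have := mul_le_mul_of_nonneg_right h1 (mul_nonneg hw2.le (norm_nonneg (h w)))
        simp only [hQdef]
        nlinarith [this]
      rw [← div_eq_mul_inv, div_div, le_div_iff₀ (by positivity)]
      linarith
    have h4 := max_circle h hh (2 * ‖μ n‖) _ (by positivity) hb z (by linarith)
    have h5 := hup μ (Finset.range n) 0 z hμ (hB' _)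
    simp only [Nat.not_lt_zero, Finset.filter_false, Finset.prod_empty, mul_one] at h5
    rw [e z, norm_mul, norm_prod, mul_assoc]
    gcongr
  have hlim : Filter.Tendsto (fun n => A' * (K / A) * (Q n)⁻¹) Filter.atTop (nhds 0) := by
    have := (tendsto_inv_atTop_zero.comp hQ).const_mul (A' * (K / A))
    simpa using this
  have := ge_of_tendsto hlim key
  simpa using this

lemma Grow.summable {κ B : ℝ} {μ : ℕ → ℂ} (hκ : 0 < κ) (h : Grow κ B μ) (hμ : ∀ i, μ i ≠ 0) :
    Summable (fun i => 1 / ‖μ i‖) := by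
  have h0 := norm_pos_iff.2 (hμ 0)
  have hs : Summable (fun i : ℕ => Real.exp B / ‖μ 0‖ * Real.exp (-κ) ^ i) :=
    (summable_geometric_of_lt_one (Real.exp_pos _).le (by rw [Real.exp_lt_one_iff]; linarith)).mul_left _
  refine Summable.of_nonneg_of_le (fun i => by positivity) (fun i => ?_) hs
  have hi := norm_pos_iff.2 (hμ i)
  have h1 := h 0 i (Nat.zero_le _)
  have e : Real.exp (B - κ * ((i:ℝ) - (0:ℕ))) = Real.exp B * Real.exp (-κ) ^ i := by
    rw [← Real.exp_nat_mul, ← Real.exp_add]; congr 1; push_cast; ring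
  rw [e] at h1
  rw [div_mul_eq_mul_div, div_le_div_iff₀ hi h0]
  linarith

lemma lagrange (κ B c : ℝ) (hκ : 0 < κ) (hc : 0 < c) (μ : ℕ → ℂ) (hinj : Function.Injective μ)
    (hμ : ∀ i, μ i ≠ 0) (hG : Grow κ B μ) (hs : SepSeq c μ) (k : ℕ) :
    ∃ G : ℂ → ℂ, Differentiable ℂ G ∧ G (μ k) = 1 ∧ (∀ i, i ≠ k → G (μ i) = 0) ∧
      ∀ z, Filter.Tendsto (fun n => ∏ i ∈ (Finset.range n).erase k, ((1 - z / μ i) / (1 - μ k / μ i)))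
        Filter.atTop (nhds (G z)) := by
  set f : ℕ → ℂ → ℂ := fun i z => if i = k then 0 else (μ k - z) / (μ i - μ k) with hf
  have hloc : ∀ R : ℝ, 0 < R → HasProdLocallyUniformlyOn (fun i z => 1 + f i z)
      (fun z => ∏' i, (1 + f i z)) (Metric.ball 0 R) := by
    intro R hR
    refine Summable.hasProdLocallyUniformlyOn_nat_one_add (u := fun i => (‖μ k‖ + R) / c * (1 / ‖μ i‖))
      Metric.isOpen_ball ((hG.summable hκ hμ).mul_left _) (Filter.Eventually.of_forall ?_) ?_
    · intro i z hz
      have hz' : ‖z‖ < R := by simpa using hz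
      have hi := norm_pos_iff.2 (hμ i)
      simp only [hf]
      split_ifs with hik
      · simp only [norm_zero]; positivity
      · rw [norm_div, div_mul_div_comm, mul_one]
        have h1 := hs k i (Ne.symm hik)
        rw [norm_sub_rev] at h1
        gcongr
        refine (norm_sub_le _ _).trans ?_
        linarith
    · intro i
      simp only [hf]
      split_ifs
      · exact continuousOn_const
      · fun_prop
  have hterm : ∀ i z, i ≠ k → 1 + f i z = (1 - z / μ i) / (1 - μ k / μ i) := by
    intro i z hik
    have h1 : μ i - μ k ≠ 0 := sub_ne_zero.2 (fun h => hik (hinj h))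
    have h2 := hμ i
    have h3 : 1 - μ k / μ i ≠ 0 := by
      rw [sub_ne_zero]; intro h
      rw [eq_div_iff h2] at h
      apply h1; rw [← h]; ring
    simp only [hf, if_neg hik]
    field_simp
    ring
  have hpr : ∀ z, HasProd (fun i => 1 + f i z) (∏' i, (1 + f i z)) := by
    intro z
    exact (hloc (‖z‖ + 1) (by positivity)).hasProd (by simp)
  refine ⟨fun z => ∏' i, (1 + f i z), ?_, ?_, ?_, ?_⟩
  · intro z
    have hd : DifferentiableOn ℂ (fun z => ∏' i, (1 + f i z)) (Metric.ball 0 (‖z‖ + 1)) := by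
      refine TendstoLocallyUniformlyOn.differentiableOn
        (hasProdLocallyUniformlyOn_iff_tendstoLocallyUniformlyOn.1 (hloc (‖z‖+1) (by positivity))) ?_
        Metric.isOpen_ball
      refine Filter.Eventually.of_forall fun s => ?_
      refine DifferentiableOn.fun_finsetProd fun i _ => ?_
      simp only [hf]
      split_ifs
      · fun_prop
      · fun_prop
    exact hd.differentiableAt (Metric.isOpen_ball.mem_nhds (by simp))
  · have : ∀ i, 1 + f i (μ k) = 1 := by
      intro i; simp only [hf]; split_ifs <;> simp
    simp only [this, tprod_one]
  · intro i hik
    have h0 : 1 + f i (μ i) = 0 := by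
      rw [hterm i _ hik, div_self (hμ i)]; simp
    have := (hpr (μ i)).tendsto_prod_nat
    refine tendsto_nhds_unique this ?_
    refine tendsto_const_nhds.congr' ?_
    filter_upwards [Filter.eventually_gt_atTop i] with n hn
    exact (Finset.prod_eq_zero (Finset.mem_range.2 hn) h0).symm
  · intro z
    refine (hpr z).tendsto_prod_nat.congr fun n => ?_
    rw [← Finset.prod_erase (Finset.range n) (f := fun i => 1 + f i z) (a := k) (by simp [hf])]
    exact Finset.prod_congr rfl fun i hi => hterm i z (Finset.ne_of_mem_erase hi)

/-- partial sums -/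
def Esum (ε : ℕ → ℝ) (n : ℕ) : ℝ := ∑ i ∈ Finset.range n, ε i

/-- The hypotheses of the sufficiency part. -/
structure Good (α : ℝ) (μ : ℕ → ℂ) (ε : ℕ → ℝ) (M c η C : ℝ) : Prop where
  hα : 0 < α
  norm : ∀ m : ℕ, ‖μ m‖ = Real.exp (((m:ℝ) + 3/2) / (2 * α) + ε m)
  inj : Function.Injective μ
  mono : ∀ i j, i ≤ j → ‖μ i‖ ≤ ‖μ j‖
  bd : ∀ m, |ε m| ≤ M
  hc : 0 < c
  hc1 : c ≤ 1
  sep : SepSeq c μ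
  hη : 0 < η
  hE : ∀ j k, j ≤ k → |Esum ε k - Esum ε j| ≤ (1 / (4 * α) - η) * ((k:ℝ) - j) + C

/-- the potential -/
def VV (α : ℝ) (ε : ℕ → ℝ) (j : ℕ) : ℝ := ((j:ℝ) + 9/4) / (4 * α) - Esum ε j

lemma sum_range_lin (j : ℕ) : ∑ i ∈ Finset.range j, ((j:ℝ) - i) = (j:ℝ) * (j + 1) / 2 := by
  have : ∀ j : ℕ, ∑ i ∈ Finset.range j, (i:ℝ) = (j:ℝ) * (j - 1) / 2 := by
    intro j
    induction j with
    | zero => simp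
    | succ n ih => rw [Finset.sum_range_succ, ih]; push_cast; ring
  rw [Finset.sum_sub_distrib, this]; simp; ring

/-- exact evaluation of the main product -/
lemma prod_exp (α : ℝ) (hα : 0 < α) (μ : ℕ → ℂ) (ε : ℕ → ℝ)
    (hn : ∀ m : ℕ, ‖μ m‖ = Real.exp (((m:ℝ) + 3/2) / (2 * α) + ε m)) (j : ℕ) (x τ : ℝ)
    (hx : x = Real.exp (((j:ℝ) + 3/2) / (2 * α) + τ)) :
    (∏ i ∈ Finset.range j, (x / ‖μ i‖)) * (x ^ (3/2:ℝ) * Real.exp (-(α * (Real.log x) ^ 2))) =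
      Real.exp (VV α ε j - α * τ ^ 2) := by
  have h1 : ∀ i ∈ Finset.range j, x / ‖μ i‖ = Real.exp (1/(2*α) * ((j:ℝ) - i) + τ - ε i) := by
    intro i _
    rw [hn, hx, ← Real.exp_sub]; congr 1; ring
  rw [Finset.prod_congr rfl h1, ← Real.exp_sum, Finset.sum_sub_distrib, Finset.sum_add_distrib,
    ← Finset.mul_sum, sum_range_lin, hx, Real.log_exp, ← Real.exp_mul, ← Real.exp_add, ← Real.exp_add]
  congr 1
  simp only [Finset.sum_const, Finset.card_range, nsmul_eq_mul, VV, Esum]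
  field_simp
  ring

lemma phi_le (α : ℝ) (hα : 0 < α) (z : ℂ) : phi α z ≤ α * (Real.log ‖z‖) ^ 2 := by
  unfold phi logPlus
  gcongr 1
  rcases le_total (Real.log ‖z‖) 0 with h | h
  · rw [max_eq_right h]; nlinarith [sq_nonneg (Real.log ‖z‖)]
  · rw [max_eq_left h]

/-- level `j` -/
def AtLev (α : ℝ) (j : ℕ) (z : ℂ) : Prop :=
  ‖z‖ ≤ Real.exp (((j:ℝ) + 5/2) / (2 * α)) ∧ (j = 0 ∨ Real.exp (((j:ℝ) + 3/2) / (2 * α)) ≤ ‖z‖)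

/-- the level function -/
def lev (α : ℝ) (z : ℂ) : ℕ := ⌊2 * α * Real.log ‖z‖ - 3/2⌋₊

lemma lev_atLev (α : ℝ) (hα : 0 < α) (z : ℂ) : AtLev α (lev α z) z := by
  unfold lev
  by_cases hz : z = 0
  · subst hz
    have : ⌊2 * α * Real.log ‖(0:ℂ)‖ - 3/2⌋₊ = 0 := by
      rw [Nat.floor_eq_zero]; norm_num
    rw [this]
    refine ⟨by simp; positivity, Or.inl rfl⟩
  have hz0 := norm_pos_iff.2 hz
  set y := 2 * α * Real.log ‖z‖ - 3/2 with hy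
  have e : ‖z‖ = Real.exp ((y + 3/2) / (2 * α)) := by
    rw [hy, sub_add_cancel, mul_div_cancel_left₀ _ (by positivity), Real.exp_log hz0]
  constructor
  · rw [e]
    have := (Nat.lt_floor_add_one y).le
    apply Real.exp_le_exp.2
    gcongr ?_ / _
    linarith
  · by_cases h : ⌊y⌋₊ = 0
    · exact Or.inl h
    · right
      rw [e]
      have := Nat.floor_le (Nat.pos_of_floor_pos (Nat.pos_of_ne_zero h)).le
      gcongr

namespace Good
variable {α : ℝ} {μ : ℕ → ℂ} {ε : ℕ → ℝ} {M c η C : ℝ}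

lemma ne (g : Good α μ ε M c η C) (i : ℕ) : μ i ≠ 0 :=
  norm_pos_iff.1 (by rw [g.norm]; exact Real.exp_pos _)

lemma grow (g : Good α μ ε M c η C) : Grow (1/(2*α)) (2*M) μ := by
  intro j k hjk
  have h1 := abs_le.1 (g.bd j)
  have h2 := abs_le.1 (g.bd k)
  rw [g.norm, g.norm, ← Real.exp_add]
  apply Real.exp_le_exp.2
  have : ((j:ℝ) + 3/2) / (2*α) = ((k:ℝ) + 3/2) / (2*α) - 1 / (2*α) * ((k:ℝ) - j) := by ring
  rw [this]; linarith

lemma levz (g : Good α μ ε M c η C) (F : Finset ℕ) (j : ℕ) (z : ℂ) (hz : AtLev α j z) :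
    Lev (1/(2*α)) (M + 1/(2*α)) μ F j z := by
  have hα := g.hα
  intro i _
  have h1 := abs_le.1 (g.bd i)
  have hκ : 0 < 1/(2*α) := by positivity
  constructor
  · intro hij
    have hij' : (i:ℝ) < j := by exact_mod_cast hij
    rcases hz.2 with h | h
    · omega
    refine le_trans ?_ (mul_le_mul_of_nonneg_left h (Real.exp_pos _).le)
    rw [g.norm, ← Real.exp_add, abs_of_neg (by linarith)]
    apply Real.exp_le_exp.2
    have : ((i:ℝ) + 3/2) / (2*α) = ((j:ℝ) + 3/2) / (2*α) - 1 / (2*α) * ((j:ℝ) - i) := by ring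
    rw [this]; linarith
  · intro hij
    have hij' : (j:ℝ) ≤ i := by exact_mod_cast hij
    refine hz.1.trans ?_
    rw [g.norm, ← Real.exp_add, abs_of_nonneg (by linarith)]
    apply Real.exp_le_exp.2
    have : ((j:ℝ) + 5/2) / (2*α) = ((i:ℝ) + 3/2) / (2*α) - 1 / (2*α) * ((i:ℝ) - j) + 1/(2*α) := by ring
    rw [this]; linarith

/-- upper bound of the weighted main product at level `j` -/
lemma upper_w (g : Good α μ ε M c η C) : ∃ A : ℝ, 0 < A ∧ ∀ j z, AtLev α j z →
    (∏ i ∈ Finset.range j, (‖z‖ / ‖μ i‖)) * wt α z ≤ A * Real.exp (VV α ε j) := by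
  have hα := g.hα
  set R := Real.exp ((5/2) / (2*α)) with hR
  refine ⟨(1 + R) ^ (3/2:ℝ) + (1 + 1/1) ^ (3/2:ℝ), by positivity, ?_⟩
  intro j z hz
  by_cases hj : j = 0
  · subst hj
    simp only [Finset.range_zero, Finset.prod_empty, one_mul]
    have h1 : ‖z‖ ≤ R := by simpa using hz.1
    have h2 : wt α z ≤ (1 + R) ^ (3/2:ℝ) * 1 := by
      unfold wt
      gcongr
      rw [Real.exp_le_one_iff]
      have : 0 ≤ phi α z := by unfold phi; positivity
      linarith
    have h3 : 1 ≤ Real.exp (VV α ε 0) := by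
      rw [Real.one_le_exp_iff]; simp [VV, Esum]; positivity
    have h4 : (0:ℝ) ≤ (1 + 1/1) ^ (3/2:ℝ) := by positivity
    have h5 : (0:ℝ) ≤ (1 + R) ^ (3/2:ℝ) := by positivity
    nlinarith
  · have h1 := hz.2.resolve_left hj
    have hz0 : 0 < ‖z‖ := (Real.exp_pos _).trans_le h1
    have hz1 : 1 ≤ ‖z‖ := le_trans (Real.one_le_exp (by positivity)) h1
    set τ := Real.log ‖z‖ - ((j:ℝ) + 3/2) / (2*α) with hτ
    have e : ‖z‖ = Real.exp (((j:ℝ) + 3/2) / (2 * α) + τ) := by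
      rw [hτ, add_sub_cancel, Real.exp_log hz0]
    have h2 := prod_exp α hα μ ε g.norm j _ τ e
    have h3 := wt_le_wt0 α 1 one_pos z hz1
    have h4 : wt0 α z = ‖z‖ ^ (3/2:ℝ) * Real.exp (-(α * (Real.log ‖z‖) ^ 2)) := by
      unfold wt0 phi logPlus
      rw [max_eq_left (Real.log_nonneg hz1)]
    rw [← h4] at h2
    have hP : 0 ≤ ∏ i ∈ Finset.range j, (‖z‖ / ‖μ i‖) := Finset.prod_nonneg fun _ _ => by positivity
    calc _ ≤ (∏ i ∈ Finset.range j, (‖z‖ / ‖μ i‖)) * ((1 + 1/1) ^ (3/2:ℝ) * wt0 α z) := by gcongr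
      _ = (1 + 1/1) ^ (3/2:ℝ) * Real.exp (VV α ε j - α * τ^2) := by rw [← h2]; ring
      _ ≤ _ := by
        gcongr
        · have : (0:ℝ) ≤ (1 + R) ^ (3/2:ℝ) := by positivity
          linarith
        · have : 0 ≤ α * τ^2 := by positivity
          linarith

lemma lower_w0 (g : Good α μ ε M c η C) (k : ℕ) (r : ℝ) (hr : 0 < r) :
    Real.exp (VV α ε k - α * (ε k + Real.log r) ^ 2) ≤
    (∏ i ∈ Finset.range k, (r * ‖μ k‖ / ‖μ i‖)) * wt0 α (r * μ k) := by
  have hα := g.hα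
  have e : r * ‖μ k‖ = Real.exp (((k:ℝ) + 3/2) / (2 * α) + (ε k + Real.log r)) := by
    rw [g.norm, ← add_assoc, Real.exp_add _ (Real.log r), Real.exp_log hr]; ring
  have hn : ‖(r:ℂ) * μ k‖ = r * ‖μ k‖ := by rw [norm_mul, Complex.norm_real, Real.norm_of_nonneg hr.le]
  rw [← prod_exp α hα μ ε g.norm k _ _ e]
  have hP : 0 ≤ ∏ i ∈ Finset.range k, (r * ‖μ k‖ / ‖μ i‖) := Finset.prod_nonneg fun _ _ => by positivity
  unfold wt0
  rw [hn]
  gcongr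
  have := phi_le α hα (r * μ k)
  rwa [hn] at this
end Good

namespace Good
variable {α : ℝ} {μ : ℕ → ℂ} {ε : ℕ → ℝ} {M c η C : ℝ}

lemma V_up (g : Good α μ ε M c η C) (j k : ℕ) (h : j ≤ k) :
    VV α ε j - VV α ε k ≤ C - η * ((k:ℝ) - j) := by
  have h1 := (abs_le.1 (g.hE j k h)).2
  have : VV α ε j - VV α ε k = -(1/(4*α) * ((k:ℝ) - j)) + (Esum ε k - Esum ε j) := by
    unfold VV; ring
  rw [this]; linarith

lemma V_down (g : Good α μ ε M c η C) (j k : ℕ) (h : k ≤ j) :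
    VV α ε j - VV α ε k ≤ C - η * ((j:ℝ) - k) + 1/(2*α) * ((j:ℝ) - k) := by
  have h1 := (abs_le.1 (g.hE k j h)).1
  have : VV α ε j - VV α ε k = 1/(4*α) * ((j:ℝ) - k) - (Esum ε j - Esum ε k) := by
    unfold VV; ring
  have e : 1/(2*α) * ((j:ℝ) - k) = 1/(4*α) * ((j:ℝ) - k) + 1/(4*α) * ((j:ℝ) - k) := by
    have := g.hα.ne'
    field_simp; ring
  rw [this, e]; linarith

lemma Mnn (g : Good α μ ε M c η C) : 0 ≤ M := (abs_nonneg _).trans (g.bd 0)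

lemma upper_erase (g : Good α μ ε M c η C) : ∃ A : ℝ, 0 < A ∧ ∀ j k z, AtLev α j z →
    (∏ i ∈ (Finset.range j).erase k, (‖z‖ / ‖μ i‖)) * wt α z ≤
      A * Real.exp (-(η * |(j:ℝ) - k|)) * Real.exp (VV α ε k) := by
  obtain ⟨A, hA, h⟩ := g.upper_w
  have hα := g.hα
  set B1 := M + 1/(2*α) with hB1
  have hB1n : 0 ≤ B1 := by have := g.Mnn; positivity
  refine ⟨A * Real.exp (B1 + C), by positivity, ?_⟩
  intro j k z hz
  have hk := norm_pos_iff.2 (g.ne k)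
  rcases lt_or_ge k j with hkj | hkj
  · have hkj' : (k:ℝ) < j := by exact_mod_cast hkj
    have h1 := (g.levz {k} j z hz k (by simp)).1 hkj
    have hz0 : 0 < ‖z‖ := by
      rcases hz.2 with h | h
      · omega
      · exact (Real.exp_pos _).trans_le h
    have h2 := h j z hz
    rw [← Finset.mul_prod_erase (Finset.range j) _ (Finset.mem_range.2 hkj)] at h2
    set P := ∏ i ∈ (Finset.range j).erase k, (‖z‖ / ‖μ i‖)
    have h3 : P * wt α z = (‖μ k‖ / ‖z‖) * (‖z‖ / ‖μ k‖ * P * wt α z) := by field_simp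
    rw [h3]
    have h4 : ‖μ k‖ / ‖z‖ ≤ Real.exp (B1 - 1/(2*α) * |(k:ℝ) - j|) := by
      rw [div_le_iff₀ hz0]; exact h1
    refine (mul_le_mul_of_nonneg_left h2 (by positivity)).trans
      ((mul_le_mul_of_nonneg_right h4 (by positivity)).trans ?_)
    have h5 := g.V_down j k hkj.le
    rw [abs_of_neg (by linarith : (k:ℝ) - j < 0), abs_of_pos (by linarith : 0 < (j:ℝ) - k)]
    rw [mul_left_comm, ← Real.exp_add, mul_assoc, mul_assoc, ← Real.exp_add, ← Real.exp_add]
    refine mul_le_mul_of_nonneg_left (Real.exp_le_exp.2 ?_) hA.le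
    linarith
  · have hkj' : (j:ℝ) ≤ k := by exact_mod_cast hkj
    rw [Finset.erase_eq_of_notMem (by simpa using hkj)]
    refine (h j z hz).trans ?_
    have h5 := g.V_up j k hkj
    rw [abs_of_nonpos (by linarith : (j:ℝ) - k ≤ 0)]
    rw [mul_assoc, mul_assoc, ← Real.exp_add, ← Real.exp_add]
    refine mul_le_mul_of_nonneg_left (Real.exp_le_exp.2 ?_) hA.le
    linarith

lemma kernel (g : Good α μ ε M c η C) : ∃ A : ℝ, 0 < A ∧ ∀ j k z, AtLev α j z → ∀ L : ℂ,
    Filter.Tendsto (fun n => ∏ i ∈ (Finset.range n).erase k, ((1 - z / μ i) / (1 - μ k / μ i)))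
        Filter.atTop (nhds L) →
    ‖L‖ * wt α z ≤ A * Real.exp (-(η * |(j:ℝ) - k|)) * wt α (μ k) := by
  have hα := g.hα
  obtain ⟨A3, hA3, h3⟩ := g.upper_erase
  obtain ⟨A1, hA1, h1⟩ := prod_upper (1/(2*α)) (by positivity) (M + 1/(2*α))
  obtain ⟨A2, hA2, h2⟩ := prod_lower (1/(2*α)) (by positivity) (2*M) c g.hc g.hc1
  set A2' := A2 * Real.exp (-(α * M^2)) with hA2'
  have hA2p : 0 < A2' := by positivity
  refine ⟨A1 * A3 / A2', by positivity, ?_⟩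
  intro j k z hz L hL
  refine le_of_tendsto ((hL.norm).mul_const (wt α z)) ?_
  filter_upwards [Filter.eventually_gt_atTop (max j k)] with n hn
  have hnj : j < n := (le_max_left _ _).trans_lt hn
  have hnk : k < n := (le_max_right _ _).trans_lt hn
  have e1 : ((Finset.range n).erase k).filter (fun i => i < j) = (Finset.range j).erase k := by
    ext i; simp only [Finset.mem_filter, Finset.mem_erase, Finset.mem_range]; omega
  have e2 : ((Finset.range n).erase k).filter (fun i => i < k) = Finset.range k := by
    ext i; simp only [Finset.mem_filter, Finset.mem_erase, Finset.mem_range]; omega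
  have hu := h1 μ ((Finset.range n).erase k) j z g.ne (g.levz _ j z hz)
  have hl := h2 μ ((Finset.range n).erase k) k (μ k) g.ne (g.ne k) (g.grow.lev _ k) (by
    intro i hi
    have hik := Finset.ne_of_mem_erase hi
    refine ⟨g.sep i k hik, ?_⟩
    rw [norm_sub_rev]; exact g.sep k i hik.symm)
  rw [e1] at hu
  rw [e2] at hl
  rw [norm_prod]
  simp only [norm_div]
  rw [Finset.prod_div_distrib]
  have h4 := g.lower_w0 k 1 one_pos
  simp only [Real.log_one, add_zero, one_mul, Complex.ofReal_one] at h4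
  set N := ∏ i ∈ (Finset.range n).erase k, ‖1 - z / μ i‖
  set D := ∏ i ∈ (Finset.range n).erase k, ‖1 - μ k / μ i‖
  set Q := ∏ i ∈ Finset.range k, (‖μ k‖ / ‖μ i‖)
  set P := ∏ i ∈ (Finset.range j).erase k, (‖z‖ / ‖μ i‖)
  have hw := wt_pos α z
  have hwk := wt_pos α (μ k)
  have hw0 := wt0_pos α (μ k) (g.ne k)
  have hQ : 0 < Q := Finset.prod_pos fun i _ => by
    have := norm_pos_iff.2 (g.ne i)
    have := norm_pos_iff.2 (g.ne k)
    positivity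
  have hD : A2' * Real.exp (VV α ε k) ≤ D * wt α (μ k) := by
    have h5 : Real.exp (-(α * M^2)) * Real.exp (VV α ε k) ≤ Q * wt0 α (μ k) := by
      refine le_trans ?_ h4
      rw [← Real.exp_add]
      apply Real.exp_le_exp.2
      have : ε k ^ 2 ≤ M ^ 2 := sq_le_sq.2 (by rw [abs_of_nonneg g.Mnn]; exact g.bd k)
      nlinarith
    calc _ = A2 * (Real.exp (-(α * M^2)) * Real.exp (VV α ε k)) := by rw [hA2']; ring
      _ ≤ A2 * (Q * wt0 α (μ k)) := by gcongr
      _ = (A2 * Q) * wt0 α (μ k) := by ring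
      _ ≤ D * wt α (μ k) := mul_le_mul hl (wt0_le_wt _ _) hw0.le ((by positivity : 0 ≤ A2 * Q).trans hl)
  have hD0 : 0 < D := (by positivity : 0 < A2 * Q).trans_le hl
  have h6 := h3 j k z hz
  have h7 : N * wt α z ≤ A1 * (A3 * Real.exp (-(η * |(j:ℝ) - k|)) * Real.exp (VV α ε k)) := by
    calc _ ≤ A1 * P * wt α z := by gcongr
      _ = A1 * (P * wt α z) := by ring
      _ ≤ _ := by gcongr
  rw [div_mul_eq_mul_div, div_le_iff₀ hD0]
  refine h7.trans ?_
  have e : A1 * A3 / A2' * Real.exp (-(η * |(j:ℝ) - k|)) * wt α (μ k) * D =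
    A1 * A3 / A2' * Real.exp (-(η * |(j:ℝ) - k|)) * (D * wt α (μ k)) := by ring
  rw [e]
  refine le_trans (le_of_eq ?_) (mul_le_mul_of_nonneg_left hD (by positivity))
  field_simp

end Good

lemma schur (η : ℝ) (hη : 0 < η) : ∃ A : ℝ, 0 < A ∧ ∀ a : ℕ → ℝ≥0∞,
    ∑' j : ℕ, (∑' k : ℕ, ENNReal.ofReal (Real.exp (-(η * |(j:ℝ) - k|))) * a k) ^ (4/3:ℝ) ≤
      ENNReal.ofReal A * ∑' k, a k ^ (4/3:ℝ) := by
  obtain ⟨A, hA, h⟩ := geo_sum η hη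
  set K : ℕ → ℕ → ℝ≥0∞ := fun j k => ENNReal.ofReal (Real.exp (-(η * |(j:ℝ) - k|))) with hK
  have hsum : ∀ k, ∑' j, K j k ≤ ENNReal.ofReal A := by
    intro k
    refine ENNReal.tsum_le_of_sum_range_le fun n => ?_
    rw [← ENNReal.ofReal_sum_of_nonneg (fun _ _ => (Real.exp_pos _).le)]
    exact ENNReal.ofReal_le_ofReal (h _ k)
  have hsumF : ∀ j (F : Finset ℕ), ∑ k ∈ F, K j k ≤ ENNReal.ofReal A := by
    intro j F
    rw [← ENNReal.ofReal_sum_of_nonneg (fun _ _ => (Real.exp_pos _).le)]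
    refine ENNReal.ofReal_le_ofReal ?_
    have := h F j
    simpa only [abs_sub_comm] using this
  refine ⟨A ^ (1/3:ℝ) * A, by positivity, fun a => ?_⟩
  have hj : ∀ j, (∑' k, K j k * a k) ^ (4/3:ℝ) ≤ ENNReal.ofReal (A ^ (1/3:ℝ)) * ∑' k, K j k * a k ^ (4/3:ℝ) := by
    intro j
    have h1 : ∑' k, K j k * a k ≤ ENNReal.ofReal A ^ (1 - (4/3:ℝ)⁻¹) * (∑' k, K j k * a k ^ (4/3:ℝ)) ^ ((4/3:ℝ)⁻¹) := by
      rw [ENNReal.tsum_eq_iSup_sum]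
      refine iSup_le fun F => ?_
      refine (ENNReal.inner_le_weight_mul_Lp_of_nonneg F (p := 4/3) (by norm_num) (K j) a).trans ?_
      gcongr
      · exact hsumF j F
      · exact ENNReal.sum_le_tsum F
    refine (ENNReal.rpow_le_rpow h1 (by norm_num)).trans ?_
    rw [ENNReal.mul_rpow_of_nonneg _ _ (by norm_num), ← ENNReal.rpow_mul, ← ENNReal.rpow_mul]
    norm_num
    rw [ENNReal.ofReal_rpow_of_pos hA]
  calc _ ≤ ∑' j, ENNReal.ofReal (A ^ (1/3:ℝ)) * ∑' k, K j k * a k ^ (4/3:ℝ) := ENNReal.tsum_le_tsum hj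
    _ = ENNReal.ofReal (A ^ (1/3:ℝ)) * ∑' k, (∑' j, K j k) * a k ^ (4/3:ℝ) := by
      rw [ENNReal.tsum_mul_left, ENNReal.tsum_comm]
      simp only [ENNReal.tsum_mul_right]
    _ ≤ ENNReal.ofReal (A ^ (1/3:ℝ)) * ∑' k, ENNReal.ofReal A * a k ^ (4/3:ℝ) := by
      gcongr with k
      exact hsum k
    _ = _ := by
      rw [ENNReal.tsum_mul_left, ← mul_assoc, ENNReal.ofReal_mul (by positivity)]

lemma level_int (α : ℝ) (hα : 0 < α) : ∃ A : ℝ, 0 < A ∧ ∀ (f : ℂ → ℂ) (b : ℕ → ℝ≥0∞),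
    (∀ z, ENNReal.ofReal ((‖f z‖ * wt α z) ^ (4/3:ℝ)) ≤ b (lev α z)) →
    fockNormP α (4/3) f ≤ ENNReal.ofReal A * ∑' j, b j := by
  set R : ℕ → ℝ := fun j => Real.exp (((j:ℝ) + 5/2) / (2 * α)) with hR
  set T := Real.exp (5/(2*α)) with hT
  have hT1 : 1 ≤ T := Real.one_le_exp (by positivity)
  refine ⟨T * Real.pi, by positivity, fun f b hb => ?_⟩
  have hpt : ∀ z, ENNReal.ofReal ((‖f z‖ * Real.exp (-(phi α z))) ^ (4/3:ℝ)) ≤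
      ∑' j, (Metric.closedBall (0:ℂ) (R j)).indicator (fun _ => ENNReal.ofReal (T / (R j)^2) * b j) z := by
    intro z
    have hl := lev_atLev α hα z
    refine le_trans ?_ (ENNReal.le_tsum (lev α z))
    rw [Set.indicator_of_mem (by simpa using hl.1)]
    refine le_trans ?_ (mul_le_mul_right (hb z) _)
    rw [← ENNReal.ofReal_mul (by positivity)]
    refine ENNReal.ofReal_le_ofReal ?_
    rw [← term_eq α z _ (norm_nonneg _), Real.mul_rpow (norm_nonneg _) (Real.exp_pos _).le, ← Real.exp_mul]
    have hR0 : 0 < R (lev α z) := Real.exp_pos _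
    have h1 : R (lev α z) ^ 2 ≤ T * (1 + ‖z‖)^2 := by
      rcases hl.2 with h | h
      · rw [h]
        have e : R 0 ^ 2 = T := by
          simp only [hR, hT]
          rw [← Real.exp_nat_mul]; congr 1; push_cast; ring
        rw [e]
        have : 1 ≤ (1 + ‖z‖)^2 := by nlinarith [norm_nonneg z]
        nlinarith
      · set j := lev α z
        have e : R j ^ 2 = Real.exp (1/α) * Real.exp (((j:ℝ) + 3/2) / (2 * α)) ^ 2 := by
          simp only [hR]
          rw [← Real.exp_nat_mul, ← Real.exp_nat_mul, ← Real.exp_add]; congr 1; push_cast; field_simp; ring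
        rw [e]
        have h2 : Real.exp (1/α) ≤ T := by
          apply Real.exp_le_exp.2
          rw [div_le_div_iff₀ hα (by positivity)]; linarith
        have h3 : Real.exp (((j:ℝ) + 3/2) / (2 * α)) ≤ 1 + ‖z‖ := by linarith
        gcongr
    have h2 : 1 ≤ T / R (lev α z) ^ 2 * (1 + ‖z‖)^2 := by
      rw [div_mul_eq_mul_div, one_le_div (by positivity)]; exact h1
    have e : Real.exp (-(phi α z) * (4/3)) = Real.exp (-(4/3 * phi α z)) := by congr 1; ring
    rw [e, ← mul_assoc, ← mul_assoc, mul_assoc]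
    set X := ‖f z‖ ^ (4/3:ℝ) * Real.exp (-(4/3 * phi α z)) with hX
    have hX0 : 0 ≤ X := by positivity
    nlinarith
  unfold fockNormP
  refine (lintegral_mono hpt).trans ?_
  rw [lintegral_tsum (fun j => (measurable_const.indicator measurableSet_closedBall).aemeasurable),
    ← ENNReal.tsum_mul_left]
  refine ENNReal.tsum_le_tsum fun j => ?_
  have hR0 : 0 < R j := Real.exp_pos _
  rw [lintegral_indicator measurableSet_closedBall, setLIntegral_const, Complex.volume_closedBall]
  have e : (NNReal.pi : ℝ≥0∞) = ENNReal.ofReal Real.pi := by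
    rw [ENNReal.ofReal, ← NNReal.coe_real_pi, Real.toNNReal_coe]
  rw [e, ← ENNReal.ofReal_pow hR0.le, mul_right_comm, ← ENNReal.ofReal_mul (by positivity),
    ← ENNReal.ofReal_mul (by positivity)]
  apply le_of_eq
  congr 2
  field_simp

namespace Good
variable {α : ℝ} {μ : ℕ → ℂ} {ε : ℕ → ℝ} {M c η C : ℝ}

lemma lev_le (hα : 0 < α) (R : ℝ) (hR : 1 ≤ R) (z : ℂ) (hz : ‖z‖ ≤ R) : (lev α z : ℝ) ≤ 2 * α * Real.log R := by
  have hl := Real.log_nonneg hR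
  rcases (lev_atLev α hα z).2 with h | h
  · rw [h]; simp; positivity
  · have h1 := h.trans hz
    rw [← Real.le_log_iff_exp_le (by linarith), div_le_iff₀ (by positivity)] at h1
    linarith

lemma wt_ge (hα : 0 < α) (R : ℝ) (hR : 1 ≤ R) (z : ℂ) (hz : ‖z‖ ≤ R) :
    Real.exp (-(α * (Real.log R)^2)) ≤ wt α z := by
  unfold wt
  have h1 : (1:ℝ) ≤ (1 + ‖z‖) ^ (3/2:ℝ) := Real.one_le_rpow (by linarith [norm_nonneg z]) (by norm_num)
  have h2 : phi α z ≤ α * (Real.log R)^2 := by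
    unfold phi logPlus
    gcongr
    apply max_le _ (Real.log_nonneg hR)
    by_cases h0 : z = 0
    · simp [h0]; exact Real.log_nonneg hR
    · exact Real.log_le_log (norm_pos_iff.2 h0) hz
  calc _ ≤ 1 * Real.exp (-(phi α z)) := by rw [one_mul]; apply Real.exp_le_exp.2; linarith
    _ ≤ _ := by gcongr

lemma interp (g : Good α μ ε M c η C) : ∃ A : ℝ, 0 < A ∧ ∀ v : ℕ → ℂ,
    ∑' k, ENNReal.ofReal ((‖v k‖ * wt α (μ k)) ^ (4/3:ℝ)) < ⊤ →
    ∃ f : ℂ → ℂ, Differentiable ℂ f ∧ (∀ k, f (μ k) = v k) ∧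
      fockNormP α (4/3) f ≤ ENNReal.ofReal A * ∑' k, ENNReal.ofReal ((‖v k‖ * wt α (μ k)) ^ (4/3:ℝ)) := by
  have hα := g.hα
  have hη := g.hη
  obtain ⟨A, hA, hker⟩ := g.kernel
  obtain ⟨A1, hA1, hsch⟩ := schur η hη
  obtain ⟨A2, hA2, hInterp⟩ := level_int α hα
  choose G hGd hG1 hG0 hGt using lagrange (1/(2*α)) (2*M) c (by positivity) g.hc μ g.inj g.ne g.grow g.sep
  refine ⟨A2 * (A ^ (4/3:ℝ) * A1), by positivity, fun v hv => ?_⟩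
  set a : ℕ → ℝ := fun k => ‖v k‖ * wt α (μ k) with ha
  have ha0 : ∀ k, 0 ≤ a k := fun k => mul_nonneg (norm_nonneg _) (wt_pos _ _).le
  obtain ⟨S, hS0, hS⟩ : ∃ S : ℝ, 0 ≤ S ∧ ∀ k, a k ≤ S := by
    refine ⟨(∑' k, ENNReal.ofReal ((a k) ^ (4/3:ℝ))).toReal ^ (3/4:ℝ), by positivity, fun k => ?_⟩
    rw [← rpow43_le (ha0 k) (by positivity), rpow43_34 ENNReal.toReal_nonneg]
    rw [← ENNReal.ofReal_le_iff_le_toReal hv.ne]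
    exact ENNReal.le_tsum k
  have hk : ∀ k z, ‖v k * G k z‖ * wt α z ≤ A * Real.exp (-(η * |(lev α z:ℝ) - k|)) * a k := by
    intro k z
    have := hker (lev α z) k z (lev_atLev α hα z) _ (hGt k z)
    rw [norm_mul, mul_assoc]
    refine (mul_le_mul_of_nonneg_left this (norm_nonneg _)).trans_eq ?_
    simp only [ha]; ring
  have hbd : ∀ R : ℝ, 1 ≤ R → ∃ D : ℝ, ∀ k z, ‖z‖ ≤ R → ‖v k * G k z‖ ≤ D * Real.exp (-η) ^ k := by
    intro R hR
    refine ⟨A * Real.exp (η * (2 * α * Real.log R)) * S * (Real.exp (-(α * (Real.log R)^2)))⁻¹, fun k z hz => ?_⟩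
    have h1 := hk k z
    have h2 := wt_ge hα R hR z hz
    have h3 := lev_le hα R hR z hz
    have h4 : Real.exp (-(η * |(lev α z:ℝ) - k|)) ≤ Real.exp (η * (2 * α * Real.log R)) * Real.exp (-η) ^ k := by
      rw [← Real.exp_nat_mul, ← Real.exp_add]
      apply Real.exp_le_exp.2
      have := neg_abs_le ((lev α z:ℝ) - k)
      nlinarith
    have h5 : ‖v k * G k z‖ * Real.exp (-(α * (Real.log R)^2)) ≤ A * (Real.exp (η * (2 * α * Real.log R)) * Real.exp (-η) ^ k) * S := by
      calc _ ≤ ‖v k * G k z‖ * wt α z := by gcongr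
        _ ≤ _ := h1
        _ ≤ _ := by
          have := hS k
          have := ha0 k
          gcongr
    rw [← le_div_iff₀ (Real.exp_pos _)] at h5
    refine h5.trans_eq ?_
    rw [div_eq_mul_inv]; ring
  have hgeo : Summable (fun k : ℕ => Real.exp (-η) ^ k) :=
    summable_geometric_of_lt_one (Real.exp_pos _).le (by rw [Real.exp_lt_one_iff]; linarith)
  set f : ℂ → ℂ := fun z => ∑' k, v k * G k z with hf
  have hsum : ∀ z, Summable (fun k => ‖v k * G k z‖) := by
    intro z
    obtain ⟨D, hD⟩ := hbd (‖z‖ + 1) (by linarith [norm_nonneg z])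
    exact Summable.of_nonneg_of_le (fun _ => norm_nonneg _) (fun k => hD k z (by linarith)) (hgeo.mul_left D)
  refine ⟨f, ?_, ?_, ?_⟩
  · intro z
    obtain ⟨D, hD⟩ := hbd (‖z‖ + 1) (by linarith [norm_nonneg z])
    have : DifferentiableOn ℂ f (Metric.ball 0 (‖z‖ + 1)) := by
      refine differentiableOn_tsum_of_summable_norm (hgeo.mul_left D) (fun k => ?_) Metric.isOpen_ball ?_
      · exact ((hGd k).const_mul (v k)).differentiableOn
      · intro k w hw
        exact hD k w (by have : ‖w‖ < ‖z‖ + 1 := by simpa using hw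
                         exact this.le)
    exact this.differentiableAt (Metric.isOpen_ball.mem_nhds (by simp))
  · intro k
    simp only [hf]
    rw [tsum_eq_single k]
    · rw [hG1, mul_one]
    · intro i hi
      rw [hG0 i k hi.symm, mul_zero]
  · set K : ℕ → ℕ → ℝ≥0∞ := fun j k => ENNReal.ofReal (Real.exp (-(η * |(j:ℝ) - k|))) with hK
    have h1 := hInterp f (fun j => (ENNReal.ofReal A * ∑' k, K j k * ENNReal.ofReal (a k)) ^ (4/3:ℝ)) (by
      intro z
      rw [← ENNReal.ofReal_rpow_of_nonneg (mul_nonneg (norm_nonneg _) (wt_pos _ _).le) (by norm_num)]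
      refine ENNReal.rpow_le_rpow ?_ (by norm_num)
      have h2 : ‖f z‖ * wt α z ≤ ∑' k, ‖v k * G k z‖ * wt α z := by
        rw [tsum_mul_right]
        exact mul_le_mul_of_nonneg_right (norm_tsum_le_tsum_norm (hsum z)) (wt_pos _ _).le
      refine (ENNReal.ofReal_le_ofReal h2).trans ?_
      rw [ENNReal.ofReal_tsum_of_nonneg (fun k => mul_nonneg (norm_nonneg _) (wt_pos _ _).le)
        ((hsum z).mul_right _), ← ENNReal.tsum_mul_left]
      refine ENNReal.tsum_le_tsum fun k => ?_
      rw [← ENNReal.ofReal_mul (Real.exp_pos _).le, ← ENNReal.ofReal_mul hA.le, ← mul_assoc]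
      exact ENNReal.ofReal_le_ofReal (hk k z))
    refine h1.trans ?_
    simp only [ENNReal.mul_rpow_of_nonneg _ _ (by norm_num : (0:ℝ) ≤ 4/3)]
    rw [ENNReal.tsum_mul_left]
    have h3 := hsch (fun k => ENNReal.ofReal (a k))
    rw [ENNReal.ofReal_mul hA2.le, ENNReal.ofReal_mul (by positivity), mul_assoc, mul_assoc,
      ← ENNReal.ofReal_rpow_of_pos hA]
    gcongr
    refine h3.trans_eq ?_
    congr 2
    ext k
    rw [ENNReal.ofReal_rpow_of_nonneg (ha0 k) (by norm_num)]
end Good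

lemma Grow.tendsto {κ B : ℝ} {μ : ℕ → ℂ} (hκ : 0 < κ) (h : Grow κ B μ) (hμ : ∀ i, μ i ≠ 0) :
    Filter.Tendsto (fun n => ‖μ n‖) Filter.atTop Filter.atTop := by
  have h1 := (h.summable hκ hμ).tendsto_atTop_zero
  have h2 : Filter.Tendsto (fun n => 1/‖μ n‖) Filter.atTop (nhdsWithin 0 (Set.Ioi 0)) := by
    rw [tendsto_nhdsWithin_iff]
    refine ⟨h1, Filter.Eventually.of_forall fun n => ?_⟩
    have := norm_pos_iff.2 (hμ n)
    simp only [Set.mem_Ioi]; positivity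
  have h3 := h2.inv_tendsto_nhdsGT_zero
  refine h3.congr fun n => ?_
  simp

namespace Good
variable {α : ℝ} {μ : ℕ → ℂ} {ε : ℕ → ℝ} {M c η C : ℝ}

lemma hQ (g : Good α μ ε M c η C) :
    Filter.Tendsto (fun n => (∏ i ∈ Finset.range n, (2 * ‖μ n‖ / ‖μ i‖)) * wt0 α (2 * μ n))
      Filter.atTop Filter.atTop := by
  have hα := g.hα
  have hη := g.hη
  have hlow : ∀ n : ℕ, Real.exp ((n:ℝ) * η + (VV α ε 0 - C - α * (M + 1)^2)) ≤
      (∏ i ∈ Finset.range n, (2 * ‖μ n‖ / ‖μ i‖)) * wt0 α (2 * μ n) := by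
    intro n
    have h1 := g.lower_w0 n 2 two_pos
    push_cast at h1
    refine le_trans (Real.exp_le_exp.2 ?_) h1
    have h2 := g.V_up 0 n (Nat.zero_le _)
    push_cast at h2
    have h3 : (ε n + Real.log 2)^2 ≤ (M + 1)^2 := by
      have hb := abs_le.1 (g.bd n)
      have hl0 : 0 < Real.log 2 := Real.log_pos (by norm_num)
      have hl1 : Real.log 2 ≤ 1 := by
        have := Real.log_le_sub_one_of_pos (two_pos : (0:ℝ) < 2); linarith
      apply sq_le_sq'
      · linarith
      · linarith
    nlinarith
  refine Filter.tendsto_atTop_mono hlow ?_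
  refine Real.tendsto_exp_atTop.comp ?_
  refine Filter.tendsto_atTop_add_const_right _ _ ?_
  exact tendsto_natCast_atTop_atTop.atTop_mul_const hη

theorem ci (g : Good α μ ε M c η C) : CompleteInterpolating α (4/3) (Set.range μ) := by
  have hα := g.hα
  obtain ⟨A, hA, hInterp⟩ := g.interp
  have h0 : 0 < ‖μ 0‖ := norm_pos_iff.2 (g.ne 0)
  obtain ⟨A', hA', hpp⟩ := pp_value α hα c g.hc g.hc1 ‖μ 0‖ h0
  constructor
  · refine ⟨max 1 (max A A'), le_max_left _ _, fun f hf => ?_⟩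
    have hup := hpp f hf.1 μ g.sep (fun k => g.mono 0 k (Nat.zero_le _))
    have hfin : ∑' k, ENNReal.ofReal ((‖f (μ k)‖ * wt α (μ k)) ^ (4/3:ℝ)) < ⊤ :=
      hup.trans_lt (ENNReal.mul_lt_top ENNReal.ofReal_lt_top hf.2)
    have hd : discNormP α (4/3) (Set.range μ) f = _ := disc_range α μ g.inj f
    rw [hd]
    have hAC : A ≤ max 1 (max A A') := (le_max_left _ _).trans (le_max_right _ _)
    have hAC' : A' ≤ max 1 (max A A') := (le_max_right _ _).trans (le_max_right _ _)
    refine ⟨?_, hup.trans (mul_le_mul_left (ENNReal.ofReal_le_ofReal hAC') _)⟩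
    obtain ⟨h, hhd, hhv, hhn⟩ := hInterp (fun k => f (μ k)) hfin
    have hhm : MemFock α (4/3) h := ⟨hhd, hhn.trans_lt (ENNReal.mul_lt_top ENNReal.ofReal_lt_top hfin)⟩
    obtain ⟨K1, hK1, hK1b⟩ := pointwise_bound α hα f hf
    obtain ⟨K2, hK2, hK2b⟩ := pointwise_bound α hα h hhm
    have hu := uniqueness α (1/(2*α)) (2*M) (by positivity) μ g.inj g.ne g.mono g.grow g.hQ
      (g.grow.tendsto (by positivity) g.ne) (fun z => f z - h z) (hf.1.sub hhd) (K1 + K2) (by positivity)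
      (by
        intro z hz
        have h1 := hK1b z hz
        have h2 := hK2b z hz
        have h3 := norm_sub_le (f z) (h z)
        have h4 := wt0_pos α z hz
        nlinarith)
      (by intro i; simp [hhv])
    have hfh : f = h := by
      funext z
      have := congrFun hu z
      simpa [sub_eq_zero] using this
    have hCpos : 0 < max 1 (max A A') := lt_of_lt_of_le one_pos (le_max_left _ _)
    rw [ENNReal.inv_mul_le_iff (by simpa using hCpos) ENNReal.ofReal_ne_top]
    nth_rw 1 [hfh]
    exact hhn.trans (mul_le_mul_left (ENNReal.ofReal_le_ofReal hAC) _)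
  · intro v hv
    rw [disc_range α μ g.inj v] at hv
    obtain ⟨h, hhd, hhv, hhn⟩ := hInterp (fun k => v (μ k)) hv
    refine ⟨h, ⟨hhd, hhn.trans_lt (ENNReal.mul_lt_top ENNReal.ofReal_lt_top hv)⟩, ?_⟩
    rintro _ ⟨k, rfl⟩
    exact hhv k
end Good

/-- The hypotheses of the necessity part. -/
structure Nec (α : ℝ) (μ : ℕ → ℂ) : Prop where
  hα : 0 < α
  inj : Function.Injective μ
  ne : ∀ i, μ i ≠ 0
  mono : ∀ i j, i ≤ j → ‖μ i‖ ≤ ‖μ j‖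
  ci : CompleteInterpolating α (4/3) (Set.range μ)

lemma fock_zero (α : ℝ) (f : ℂ → ℂ) (hf : Differentiable ℂ f) (h : fockNormP α (4/3) f = 0) : f = 0 := by
  have hc : Continuous f := hf.continuous
  have hphi : Measurable (fun z : ℂ => phi α z) := by
    unfold phi logPlus
    fun_prop
  unfold fockNormP at h
  rw [lintegral_eq_zero_iff (by
    have := hc.measurable
    fun_prop)] at h
  have h2 : f =ᵐ[volume] (0 : ℂ → ℂ) := by
    filter_upwards [h] with z hz
    simp only [Pi.zero_apply, ENNReal.ofReal_eq_zero] at hz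
    by_contra h0
    have : 0 < ‖f z‖ := norm_pos_iff.2 h0
    have : 0 < (‖f z‖ * Real.exp (-(phi α z))) ^ (4/3:ℝ) := by positivity
    linarith
  exact (hc.ae_eq_iff_eq volume continuous_const).1 h2

namespace Nec
variable {α : ℝ} {μ : ℕ → ℂ}

lemma samp (n : Nec α μ) : ∃ S : ℝ, 0 < S ∧ ∀ f, MemFock α (4/3) f →
    fockNormP α (4/3) f ≤ ENNReal.ofReal S * ∑' k, ENNReal.ofReal ((‖f (μ k)‖ * wt0 α (μ k)) ^ (4/3:ℝ)) := by
  obtain ⟨C, hC, h⟩ := n.ci.1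
  have h0 : 0 < ‖μ 0‖ := norm_pos_iff.2 (n.ne 0)
  set W := (1 + 1/‖μ 0‖) ^ (3/2:ℝ) with hW
  have hW0 : 0 < W := by positivity
  refine ⟨C * W ^ (4/3:ℝ), by positivity, fun f hf => ?_⟩
  have h1 := (h f hf).1
  rw [ENNReal.inv_mul_le_iff (by simp; linarith) ENNReal.ofReal_ne_top] at h1
  refine h1.trans ?_
  have hd : discNormP α (4/3) (Set.range μ) f = _ := disc_range α μ n.inj f
  rw [hd, ENNReal.ofReal_mul (by linarith), mul_assoc, ← ENNReal.tsum_mul_left (a := ENNReal.ofReal (W ^ (4/3:ℝ)))]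
  gcongr with k
  rw [← ENNReal.ofReal_mul (by positivity)]
  apply ENNReal.ofReal_le_ofReal
  have hwp := wt_pos α (μ k)
  have hwp0 := wt0_pos α (μ k) (n.ne k)
  rw [← Real.mul_rpow hW0.le (by positivity)]
  refine Real.rpow_le_rpow (by positivity) ?_ (by norm_num)
  have := wt_le_wt0 α _ h0 (μ k) (n.mono 0 k (Nat.zero_le _))
  rw [mul_left_comm]
  gcongr

lemma uniq (n : Nec α μ) (f : ℂ → ℂ) (hf : MemFock α (4/3) f) (h0 : ∀ k, f (μ k) = 0) : f = 0 := by
  obtain ⟨S, hS, h⟩ := n.samp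
  apply fock_zero α f hf.1
  have := h f hf
  simpa [h0] using this

lemma samp_one (n : Nec α μ) : ∃ S : ℝ, 0 < S ∧ ∀ f, MemFock α (4/3) f → ∀ k, (∀ i, i ≠ k → f (μ i) = 0) →
    fockNormP α (4/3) f ≤ ENNReal.ofReal ((S * (‖f (μ k)‖ * wt0 α (μ k))) ^ (4/3:ℝ)) := by
  obtain ⟨S, hS, h⟩ := n.samp
  refine ⟨S ^ (3/4:ℝ), by positivity, fun f hf k hk => (h f hf).trans ?_⟩
  have hwp0 := wt0_pos α (μ k) (n.ne k)
  rw [tsum_eq_single k, Real.mul_rpow (x := S ^ (3/4:ℝ)) (by positivity) (by positivity), rpow43_34 hS.le,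
    ENNReal.ofReal_mul hS.le]
  intro i hi
  rw [hk i hi]; simp

lemma exists_g (n : Nec α μ) (k : ℕ) : ∃ g, MemFock α (4/3) g ∧ g (μ k) = 1 ∧ ∀ i, i ≠ k → g (μ i) = 0 := by
  classical
  obtain ⟨g, hg, hv⟩ := n.ci.2 (fun z => if z = μ k then 1 else 0) (by
    rw [disc_range α μ n.inj (fun z => if z = μ k then 1 else 0), tsum_eq_single k]
    · exact ENNReal.ofReal_lt_top
    · intro i hi
      rw [if_neg (fun h => hi (n.inj h))]; simp)
  refine ⟨g, hg, ?_, fun i hi => ?_⟩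
  · rw [hv _ ⟨k, rfl⟩, if_pos rfl]
  · rw [hv _ ⟨i, rfl⟩, if_neg (fun h => hi (n.inj h))]

lemma sep (n : Nec α μ) : ∃ c : ℝ, 0 < c ∧ c ≤ 1 ∧ SepSeq c μ := by
  have hα := n.hα
  obtain ⟨S, hS, h⟩ := n.samp_one
  obtain ⟨C, hC, hb⟩ := twist_bound α hα
  set T := C * S with hT
  have hT0 : 0 < T := by positivity
  refine ⟨min (1/4) (1/(8*T)), by positivity, (min_le_left _ _).trans (by norm_num), ?_⟩
  intro i k hik
  have hk0 := norm_pos_iff.2 (n.ne k)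
  obtain ⟨g, hg, hg1, hg0⟩ := n.exists_g k
  have hw0 := wt0_pos α (μ k) (n.ne k)
  have h1 := h g hg k hg0
  rw [hg1, norm_one, one_mul] at h1
  have h2 : ∀ w, ‖w - μ k‖ ≤ 1/4 * ‖μ k‖ → ‖twist α g (μ k) w‖ ≤ T := by
    intro w hw
    have := hb g hg.1 (S * wt0 α (μ k)) (by positivity) h1 (μ k) (n.ne k) w hw
    rw [← mul_assoc] at this
    exact le_of_mul_le_mul_right this hw0
  by_cases hd : ‖μ i - μ k‖ < 1/4 * ‖μ k‖
  · have hdiff : DifferentiableOn ℂ (twist α g (μ k)) (Metric.ball (μ k) (1/4 * ‖μ k‖)) := by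
      intro x hx
      rw [mem_ball_iff_norm] at hx
      have hx0 := (twist_weight α hα g (μ k) x (n.ne k) (by linarith)).1
      apply DifferentiableAt.differentiableWithinAt
      unfold twist
      exact (hg.1 x).mul (((differentiableAt_const _).div differentiableAt_id hx0).pow _)
    have hm : Set.MapsTo (twist α g (μ k)) (Metric.ball (μ k) (1/4 * ‖μ k‖))
        (Metric.closedBall (twist α g (μ k) (μ k)) (2 * T)) := by
      intro x hx
      rw [mem_ball_iff_norm] at hx
      rw [mem_closedBall_iff_norm]
      have a1 := h2 x hx.le
      have a2 := h2 (μ k) (by simp)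
      exact (norm_sub_le _ _).trans (by linarith)
    have h3 := Complex.dist_le_div_mul_dist_of_mapsTo_ball hdiff hm (mem_ball_iff_norm.2 hd)
    rw [twist_self α g _ (n.ne k), hg1] at h3
    have h4 : twist α g (μ k) (μ i) = 0 := by unfold twist; rw [hg0 i hik, zero_mul]
    rw [h4, dist_eq_norm, dist_eq_norm, zero_sub, norm_neg, norm_one] at h3
    have h5 : ‖μ k‖ ≤ 8 * T * ‖μ i - μ k‖ := by
      have e : 2 * T / (1/4 * ‖μ k‖) * ‖μ i - μ k‖ = 8 * T * ‖μ i - μ k‖ / ‖μ k‖ := by field_simp; ring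
      rw [e, le_div_iff₀ hk0, one_mul] at h3
      exact h3
    calc _ ≤ 1/(8*T) * ‖μ k‖ := by gcongr; exact min_le_right _ _
      _ ≤ 1/(8*T) * (8 * T * ‖μ i - μ k‖) := by gcongr
      _ = _ := by field_simp
  · push Not at hd
    refine le_trans ?_ hd
    gcongr
    exact min_le_left _ _

end Nec

lemma geo_growth (C : ℝ) (hC : 0 < C) (n : ℕ) (x : ℕ → ℝ) (hx : ∀ i, 0 < x i)
    (h : ∀ k ≤ n, ∑ j ∈ Finset.range k, x j ≤ C * x k) (j k : ℕ) (hjk : j ≤ k) (hk : k ≤ n) :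
    x j ≤ (C + 1) * (C / (C + 1)) ^ (k - j) * x k := by
  set r := C / (C + 1) with hr
  have hr0 : 0 < r := by positivity
  set S : ℕ → ℝ := fun k => ∑ j ∈ Finset.range k, x j with hS
  have hS0 : ∀ k, 0 ≤ S k := fun k => Finset.sum_nonneg fun i _ => (hx i).le
  have hstep : ∀ k ≤ n, S k ≤ r * S (k + 1) := by
    intro k hk
    have h1 : S (k + 1) = S k + x k := Finset.sum_range_succ _ _
    have h2 : S k ≤ C * x k := h k hk
    rw [h1, hr, div_mul_eq_mul_div, le_div_iff₀ (by positivity)]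
    nlinarith
  have hxS : ∀ k ≤ n, S (k + 1) ≤ (C + 1) * x k := by
    intro k hk
    have h1 : S (k + 1) = S k + x k := Finset.sum_range_succ _ _
    have h2 : S k ≤ C * x k := h k hk
    linarith
  have hiter : ∀ m, j + m ≤ n → S (j + 1) ≤ r ^ m * S (j + m + 1) := by
    intro m
    induction m with
    | zero => intro _; simp
    | succ m ih =>
      intro hm
      refine (ih (by omega)).trans ?_
      rw [pow_succ, mul_assoc]
      gcongr
      exact hstep (j + m + 1) (by omega)
  have h3 := hiter (k - j) (by omega)
  rw [Nat.add_sub_cancel' hjk] at h3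
  have h4 : x j ≤ S (j + 1) := by
    have h1 : S (j + 1) = S j + x j := Finset.sum_range_succ _ _
    linarith [hS0 j]
  calc _ ≤ r ^ (k - j) * S (k + 1) := h4.trans h3
    _ ≤ r ^ (k - j) * ((C + 1) * x k) := by gcongr; exact hxS k hk
    _ = _ := by ring

lemma log_growth (C : ℝ) (hC : 0 < C) : ∃ η A : ℝ, 0 < η ∧ ∀ (j k : ℕ) (a b : ℝ), j ≤ k → 0 < a → 0 < b →
    a ^ (4/3:ℝ) ≤ (C + 1) * (C / (C + 1)) ^ (k - j) * b ^ (4/3:ℝ) →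
    Real.log a ≤ Real.log b - η * ((k:ℝ) - j) + A := by
  refine ⟨3/4 * Real.log ((C + 1)/C), 3/4 * Real.log (C + 1), ?_, ?_⟩
  · have : 0 < Real.log ((C + 1)/C) := Real.log_pos (by rw [one_lt_div hC]; linarith)
    positivity
  intro j k a b hjk ha hb h
  have h1 := Real.log_le_log (by positivity) h
  rw [Real.log_rpow ha, Real.log_mul (by positivity) (by positivity), Real.log_mul (by positivity) (by positivity),
    Real.log_rpow hb, Real.log_pow, Nat.cast_sub hjk] at h1
  have e : Real.log (C / (C + 1)) = -Real.log ((C + 1) / C) := by rw [← Real.log_inv, inv_div]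
  rw [e] at h1
  linarith

lemma geo_two (C : ℝ) (hC : 0 < C) (D Y : ℕ → ℝ) (hD : ∀ i, 0 < D i) (hY : ∀ i, 0 < Y i)
    (h1 : ∀ k (s : Finset ℕ), (∀ j ∈ s, j < k) → ∑ j ∈ s, D j ^ (4/3:ℝ) ≤ C * D k ^ (4/3:ℝ))
    (h2 : ∀ k (s : Finset ℕ), (∀ j ∈ s, k < j) → ∑ j ∈ s, Y j ^ (4/3:ℝ) ≤ C * Y k ^ (4/3:ℝ)) :
    ∃ η A : ℝ, 0 < η ∧ ∀ j k : ℕ, j ≤ k → Real.log (D j) ≤ Real.log (D k) - η * ((k:ℝ) - j) + A ∧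
      Real.log (Y k) ≤ Real.log (Y j) - η * ((k:ℝ) - j) + A := by
  obtain ⟨η, A, hη, h⟩ := log_growth C hC
  refine ⟨η, A, hη, fun j k hjk => ⟨?_, ?_⟩⟩
  · refine h j k _ _ hjk (hD j) (hD k) ?_
    exact geo_growth C hC k (fun i => D i ^ (4/3:ℝ)) (fun i => Real.rpow_pos_of_pos (hD i) _)
      (fun m _ => h1 m _ (fun i hi => Finset.mem_range.1 hi)) j k hjk le_rfl
  · refine h j k _ _ hjk (hY k) (hY j) ?_
    have := geo_growth C hC k (fun i => Y (k - i) ^ (4/3:ℝ)) (fun i => Real.rpow_pos_of_pos (hY _) _)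
      (fun m hm => ?_) 0 (k - j) (Nat.zero_le _) (Nat.sub_le _ _)
    · simpa [Nat.sub_sub_self hjk] using this
    · have hinj : Set.InjOn (fun i => k - i) (Finset.range m) := by
        intro a ha b hb hab
        simp only [Finset.coe_range, Set.mem_Iio] at ha hb
        simp only at hab
        omega
      rw [← Finset.sum_image (f := fun i => Y i ^ (4/3:ℝ)) hinj]
      apply h2
      intro i hi
      obtain ⟨a, ha, rfl⟩ := Finset.mem_image.1 hi
      have := Finset.mem_range.1 ha
      omega

/-- The generating function. -/
structure Gen (α : ℝ) (μ : ℕ → ℂ) (G g0 : ℂ → ℂ) : Prop where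
  nec : Nec α μ
  mem : MemFock α (4/3) g0
  one : g0 (μ 0) = 1
  zero : ∀ i, i ≠ 0 → g0 (μ i) = 0
  eq : ∀ z, G z = (1 - z / μ 0) * g0 z

namespace Gen
variable {α : ℝ} {μ : ℕ → ℂ} {G g0 : ℂ → ℂ}

lemma diff (h : Gen α μ G g0) : Differentiable ℂ G := by
  have : G = fun z => (1 - z / μ 0) * g0 z := funext h.eq
  rw [this]
  have := h.mem.1
  fun_prop

lemma zeros (h : Gen α μ G g0) (k : ℕ) : G (μ k) = 0 := by
  rw [h.eq]
  by_cases hk : k = 0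
  · subst hk; rw [div_self (h.nec.ne 0)]; simp
  · rw [h.zero k hk, mul_zero]

lemma ne_zero (h : Gen α μ G g0) : G ≠ 0 := by
  intro h0
  have h1 : ∀ z, z ≠ μ 0 → g0 z = 0 := by
    intro z hz
    have := h.eq z
    rw [h0, Pi.zero_apply, eq_comm, mul_eq_zero] at this
    rcases this with h2 | h2
    · exfalso; apply hz
      rw [sub_eq_zero, eq_div_iff (h.nec.ne 0), one_mul] at h2
      exact h2.symm
    · exact h2
  have h2 : g0 = fun _ => 0 := by
    refine h.mem.1.continuous.ext_on (dense_compl_singleton (μ 0)) continuous_const ?_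
    intro z hz
    exact h1 z hz
  have := h.one
  rw [h2] at this
  exact zero_ne_one this

lemma mem_dslope (h : Gen α μ G g0) (a : ℂ) (ha : G a = 0) : MemFock α (4/3) (dslope G a) := by
  have h0 := norm_pos_iff.2 (h.nec.ne 0)
  refine memFock_of_le α h.nec.hα _ g0 (dslope_diff G h.diff a) h.mem (2 * (1 + 1/‖μ 0‖)) (2 * ‖a‖ + 1)
    (by positivity) ?_
  intro z hz
  have e := dslope_mul G a ha z
  rw [h.eq] at e
  have e' := congrArg norm e
  rw [norm_mul, norm_mul] at e'
  have h1 : ‖z‖ / 2 ≤ ‖z - a‖ := by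
    have := norm_sub_norm_le z a; linarith
  have hz1 : 1 ≤ ‖z‖ := by linarith [norm_nonneg a]
  have h2 : ‖1 - z / μ 0‖ ≤ (1 + 1/‖μ 0‖) * ‖z‖ := by
    refine (norm_sub_le _ _).trans ?_
    rw [norm_one, norm_div, add_mul, one_mul, one_div_mul_eq_div]
    linarith
  have h3 : ‖z‖ / 2 * ‖dslope G a z‖ ≤ (1 + 1/‖μ 0‖) * ‖z‖ * ‖g0 z‖ := by
    calc _ ≤ ‖z - a‖ * ‖dslope G a z‖ := by gcongr
      _ = _ := e'.symm
      _ ≤ _ := by gcongr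
  have h4 : ‖z‖ * ‖dslope G a z‖ ≤ ‖z‖ * (2 * (1 + 1/‖μ 0‖) * ‖g0 z‖) := by linarith
  exact le_of_mul_le_mul_left h4 (by linarith)

lemma dslope_ne (h : Gen α μ G g0) (a : ℂ) (ha : G a = 0) : ∃ k, dslope G a (μ k) ≠ 0 := by
  by_contra hcon
  push Not at hcon
  have := h.nec.uniq _ (h.mem_dslope a ha) hcon
  apply h.ne_zero
  funext z
  rw [dslope_mul G a ha z, this]; simp

lemma dslope_other (h : Gen α μ G g0) (a : ℂ) (ha : G a = 0) (k : ℕ) (hk : μ k ≠ a) : dslope G a (μ k) = 0 := by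
  have := dslope_mul G a ha (μ k)
  rw [h.zeros, eq_comm, mul_eq_zero] at this
  exact this.resolve_left (sub_ne_zero.2 hk)

lemma zero_mem (h : Gen α μ G g0) (a : ℂ) (ha : G a = 0) : ∃ k, a = μ k := by
  obtain ⟨k, hk⟩ := h.dslope_ne a ha
  refine ⟨k, ?_⟩
  by_contra hne
  exact hk (h.dslope_other a ha k (Ne.symm hne))

lemma deriv_ne (h : Gen α μ G g0) (k : ℕ) : deriv G (μ k) ≠ 0 := by
  obtain ⟨i, hi⟩ := h.dslope_ne (μ k) (h.zeros k)
  have : μ i = μ k := by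
    by_contra hne
    exact hi (h.dslope_other _ (h.zeros k) i hne)
  rw [this, dslope_same] at hi
  exact hi

lemma deriv_q (h : Gen α μ G g0) (j k : ℕ) (hjk : j ≠ k) :
    deriv G (μ j) = (μ j - μ k) * deriv (dslope G (μ k)) (μ j) := by
  have e : G = fun z => (z - μ k) * dslope G (μ k) z := funext fun z => dslope_mul G _ (h.zeros k) z
  have hd := dslope_diff G h.diff (μ k)
  have h1 : HasDerivAt (fun z => (z - μ k) * dslope G (μ k) z)
      (1 * dslope G (μ k) (μ j) + (μ j - μ k) * deriv (dslope G (μ k)) (μ j)) (μ j) :=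
    ((hasDerivAt_id (μ j)).sub_const (μ k)).mul (hd (μ j)).hasDerivAt
  rw [← e] at h1
  rw [h1.deriv, h.dslope_other _ (h.zeros k) j (fun hh => hjk (h.nec.inj hh))]
  ring

/-- the weights `D_k` -/
lemma sums (h : Gen α μ G g0) : ∃ C : ℝ, 0 < C ∧ ∀ k (s : Finset ℕ), (∀ j ∈ s, j ≠ k) →
    ∑ j ∈ s, (‖deriv G (μ j)‖ / ‖μ j - μ k‖ * ‖μ j‖ * wt0 α (μ j)) ^ (4/3:ℝ) ≤
      C * (‖deriv G (μ k)‖ * wt0 α (μ k)) ^ (4/3:ℝ) := by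
  obtain ⟨c, hc, hc1, hs⟩ := h.nec.sep
  obtain ⟨C, hC, hp⟩ := pp_deriv α h.nec.hα c hc hc1
  obtain ⟨S, hS, hS1⟩ := h.nec.samp_one
  refine ⟨C * S ^ (4/3:ℝ), by positivity, fun k s hsk => ?_⟩
  have hw := wt0_pos α (μ k) (h.nec.ne k)
  have h1 := hp (dslope G (μ k)) (dslope_diff G h.diff _) μ hs h.nec.ne s
    (fun j hj => h.dslope_other _ (h.zeros k) j (fun hh => hsk j hj (h.nec.inj hh)))
  have h2 := hS1 _ (h.mem_dslope _ (h.zeros k)) k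
    (fun i hi => h.dslope_other _ (h.zeros k) i (fun hh => hi (h.nec.inj hh)))
  rw [dslope_same] at h2
  have h3 := h1.trans (mul_le_mul_right h2 _)
  have hnn : ∀ j ∈ s, 0 ≤ (‖deriv (dslope G (μ k)) (μ j)‖ * ‖μ j‖ * wt0 α (μ j)) ^ (4/3:ℝ) := by
    intro j _
    have := wt0_pos α (μ j) (h.nec.ne j)
    positivity
  rw [← ENNReal.ofReal_sum_of_nonneg hnn, ← ENNReal.ofReal_mul hC.le, ENNReal.ofReal_le_ofReal_iff (by positivity),
    Real.mul_rpow (x := S) hS.le (by positivity), ← mul_assoc] at h3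
  refine le_trans (le_of_eq (Finset.sum_congr rfl fun j hj => ?_)) h3
  have hne : ‖μ j - μ k‖ ≠ 0 := norm_ne_zero_iff.2 (sub_ne_zero.2 (fun hh => hsk j hj (h.nec.inj hh)))
  rw [h.deriv_q j k (hsk j hj), norm_mul, mul_div_cancel_left₀ _ hne]

end Gen

namespace Gen
variable {α : ℝ} {μ : ℕ → ℂ} {G g0 : ℂ → ℂ}

lemma two (h : Gen α μ G g0) : ∃ η A : ℝ, 0 < η ∧ ∀ j k : ℕ, j ≤ k →
    Real.log (‖deriv G (μ j)‖ * ‖μ j‖ * wt0 α (μ j)) ≤ Real.log (‖deriv G (μ k)‖ * ‖μ k‖ * wt0 α (μ k)) - η * ((k:ℝ) - j) + A ∧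
    Real.log (‖deriv G (μ k)‖ * wt0 α (μ k)) ≤ Real.log (‖deriv G (μ j)‖ * wt0 α (μ j)) - η * ((k:ℝ) - j) + A := by
  obtain ⟨C, hC, hs⟩ := h.sums
  have hw : ∀ k, 0 < wt0 α (μ k) := fun k => wt0_pos α _ (h.nec.ne k)
  have hn : ∀ k, 0 < ‖μ k‖ := fun k => norm_pos_iff.2 (h.nec.ne k)
  have hd : ∀ k, 0 < ‖deriv G (μ k)‖ := fun k => norm_pos_iff.2 (h.deriv_ne k)
  have hne : ∀ j k, j ≠ k → 0 < ‖μ j - μ k‖ := fun j k hjk =>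
    norm_pos_iff.2 (sub_ne_zero.2 (fun hh => hjk (h.nec.inj hh)))
  refine geo_two (2 ^ (4/3:ℝ) * C) (by positivity) _ _ (fun i => ?_) (fun i => ?_) ?_ ?_
  · have := hw i; have := hn i; have := hd i; positivity
  · have := hw i; have := hd i; positivity
  · intro k s hsk
    have h1 := hs k s (fun j hj => (hsk j hj).ne)
    have h2 : ∀ j ∈ s, (‖deriv G (μ j)‖ * ‖μ j‖ * wt0 α (μ j)) ^ (4/3:ℝ) ≤ (2 * ‖μ k‖) ^ (4/3:ℝ) *
        (‖deriv G (μ j)‖ / ‖μ j - μ k‖ * ‖μ j‖ * wt0 α (μ j)) ^ (4/3:ℝ) := by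
      intro j hj
      have := hw j; have := hn j; have := hd j; have h3 := hn k; have h4 := hne j k (hsk j hj).ne
      rw [← Real.mul_rpow (by positivity) (by positivity)]
      refine Real.rpow_le_rpow (by positivity) ?_ (by norm_num)
      have h5 : ‖μ j - μ k‖ ≤ 2 * ‖μ k‖ := by
        have := norm_sub_le (μ j) (μ k)
        have := h.nec.mono j k (hsk j hj).le
        linarith
      have h6 : 1 ≤ 2 * ‖μ k‖ / ‖μ j - μ k‖ := by rwa [one_le_div h4]
      calc _ = 1 * (‖deriv G (μ j)‖ * ‖μ j‖ * wt0 α (μ j)) := by ring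
        _ ≤ (2 * ‖μ k‖ / ‖μ j - μ k‖) * (‖deriv G (μ j)‖ * ‖μ j‖ * wt0 α (μ j)) := by gcongr
        _ = _ := by ring
    refine (Finset.sum_le_sum h2).trans ?_
    rw [← Finset.mul_sum]
    have := hw k; have := hn k; have := hd k
    calc _ ≤ (2 * ‖μ k‖) ^ (4/3:ℝ) * (C * (‖deriv G (μ k)‖ * wt0 α (μ k)) ^ (4/3:ℝ)) := by gcongr
      _ = _ := by
        rw [Real.mul_rpow (by positivity) (by positivity), Real.mul_rpow (by positivity) (by positivity),
          Real.mul_rpow (by positivity) (by positivity), Real.mul_rpow (by positivity) (by positivity)]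
        ring
  · intro k s hsk
    have h1 := hs k s (fun j hj => (hsk j hj).ne')
    have h2 : ∀ j ∈ s, (‖deriv G (μ j)‖ * wt0 α (μ j)) ^ (4/3:ℝ) ≤ 2 ^ (4/3:ℝ) *
        (‖deriv G (μ j)‖ / ‖μ j - μ k‖ * ‖μ j‖ * wt0 α (μ j)) ^ (4/3:ℝ) := by
      intro j hj
      have := hw j; have := hn j; have := hd j; have h3 := hn k; have h4 := hne j k (hsk j hj).ne'
      rw [← Real.mul_rpow (by positivity) (by positivity)]
      refine Real.rpow_le_rpow (by positivity) ?_ (by norm_num)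
      have h5 : ‖μ j - μ k‖ ≤ 2 * ‖μ j‖ := by
        have := norm_sub_le (μ j) (μ k)
        have := h.nec.mono k j (hsk j hj).le
        linarith
      have h6 : 1 ≤ 2 * ‖μ j‖ / ‖μ j - μ k‖ := by rwa [one_le_div h4]
      calc _ = 1 * (‖deriv G (μ j)‖ * wt0 α (μ j)) := by ring
        _ ≤ (2 * ‖μ j‖ / ‖μ j - μ k‖) * (‖deriv G (μ j)‖ * wt0 α (μ j)) := by gcongr
        _ = _ := by ring
    refine (Finset.sum_le_sum h2).trans ?_
    rw [← Finset.mul_sum, mul_assoc]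
    gcongr

/-- the combined form -/
lemma two' (h : Gen α μ G g0) : ∃ η A : ℝ, 0 < η ∧ ∀ j k : ℕ, j ≤ k →
    η * ((k:ℝ) - j) - A ≤ Real.log (‖deriv G (μ k)‖ * ‖μ k‖ * wt0 α (μ k)) - Real.log (‖deriv G (μ j)‖ * ‖μ j‖ * wt0 α (μ j)) ∧
    Real.log (‖deriv G (μ k)‖ * ‖μ k‖ * wt0 α (μ k)) - Real.log (‖deriv G (μ j)‖ * ‖μ j‖ * wt0 α (μ j)) ≤
      Real.log ‖μ k‖ - Real.log ‖μ j‖ - η * ((k:ℝ) - j) + A := by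
  obtain ⟨η, A, hη, hh⟩ := h.two
  refine ⟨η, A, hη, fun j k hjk => ?_⟩
  obtain ⟨h1, h2⟩ := hh j k hjk
  have e : ∀ k, Real.log (‖deriv G (μ k)‖ * ‖μ k‖ * wt0 α (μ k)) =
      Real.log ‖μ k‖ + Real.log (‖deriv G (μ k)‖ * wt0 α (μ k)) := by
    intro k
    have h1 := wt0_pos α _ (h.nec.ne k)
    have h2 := norm_pos_iff.2 (h.nec.ne k)
    have h3 := norm_pos_iff.2 (h.deriv_ne k)
    rw [← Real.log_mul h2.ne' (by positivity)]
    congr 1; ring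
  constructor
  · linarith
  · rw [e, e]; linarith

lemma grow (h : Gen α μ G g0) : ∃ κ B : ℝ, 0 < κ ∧ Grow κ B μ := by
  obtain ⟨η, A, hη, hh⟩ := h.two'
  refine ⟨2 * η, 2 * A, by positivity, fun j k hjk => ?_⟩
  obtain ⟨h1, h2⟩ := hh j k hjk
  have hj := norm_pos_iff.2 (h.nec.ne j)
  have hk := norm_pos_iff.2 (h.nec.ne k)
  rw [← Real.log_le_log_iff hj (by positivity), Real.log_mul (by positivity) hk.ne', Real.log_exp]
  linarith
end Gen

lemma bc_bound (h : ℂ → ℂ) (hh : Differentiable ℂ h) (R M : ℝ) (hR : 0 < R) (hM : 0 < M)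
    (h0 : ∀ z, ‖z‖ < R → h z ≠ 0) (hb : ∀ z, ‖z‖ < R → ‖h z‖ ≤ Real.exp M * ‖h 0‖) (z : ℂ) (hz : 2 * ‖z‖ < R) :
    Real.exp (-(4 * M * ‖z‖ / R)) * ‖h 0‖ ≤ ‖h z‖ ∧ ‖h z‖ ≤ Real.exp (4 * M * ‖z‖ / R) * ‖h 0‖ := by
  have hd : DifferentiableOn ℂ (fun z => deriv h z / h z) (Metric.ball 0 R) := by
    apply DifferentiableOn.div
    · exact (hh.differentiableOn (s := Set.univ)).deriv isOpen_univ |>.mono (Set.subset_univ _)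
    · exact hh.differentiableOn
    · intro z hz; exact h0 z (by simpa using hz)
  obtain ⟨L, hL0, hL⟩ := hd.isExactOn_ball.with_val_at 0 0
  have hconst : ∀ w ∈ Metric.ball (0:ℂ) R, h w * exp (-L w) = h 0 * exp (-L 0) := by
    intro w hw
    have hder : ∀ w ∈ Metric.ball (0:ℂ) R, HasDerivAt (fun w => h w * exp (-L w)) 0 w := by
      intro w hw
      have h1 := (hh w).hasDerivAt.mul ((hL w hw).neg.cexp)
      refine HasDerivAt.congr_deriv h1 ?_
      have hne0 : h w ≠ 0 := h0 w (by simpa using hw)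
      show deriv h w * exp (-L w) + h w * (exp (-L w) * -(deriv h w / h w)) = 0
      rw [mul_neg, mul_neg, mul_left_comm, mul_div_cancel₀ _ hne0]
      ring
    refine (Metric.isOpen_ball (x := (0:ℂ)) (ε := R)).is_const_of_deriv_eq_zero (convex_ball _ _).isPreconnected
      (fun w hw => (hder w hw).differentiableAt.differentiableWithinAt) (fun w hw => (hder w hw).deriv)
      hw (by simpa using hR)
  have hexp : ∀ w, ‖w‖ < R → ‖h w‖ = ‖h 0‖ * Real.exp (L w).re := by
    intro w hw
    have h1 := hconst w (by simpa using hw)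
    rw [hL0, neg_zero, exp_zero, mul_one, exp_neg, ← div_eq_mul_inv, div_eq_iff (exp_ne_zero _)] at h1
    rw [h1, norm_mul, norm_exp]
  have h00 : 0 < ‖h 0‖ := norm_pos_iff.2 (h0 0 (by simpa using hR))
  have hre : Set.MapsTo L (Metric.ball 0 R) {z | z.re ≤ M} := by
    intro w hw
    have hw' : ‖w‖ < R := by simpa using hw
    have h1 := hb w hw'
    rw [hexp w hw', mul_comm] at h1
    have h2 := le_of_mul_le_mul_right h1 h00
    exact Real.exp_le_exp.1 h2
  have hzR : ‖z‖ < R := by linarith [norm_nonneg z]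
  have h1 := borelCaratheodory_zero hM (fun w hw => (hL w hw).differentiableAt.differentiableWithinAt) hre hR
    (z := z) (by simpa using hzR) hL0
  have h2 : ‖L z‖ ≤ 4 * M * ‖z‖ / R := by
    refine h1.trans ?_
    rw [div_le_div_iff₀ (by linarith) hR]
    have : 0 ≤ M * ‖z‖ := by positivity
    nlinarith
  have h3 := abs_le.1 ((abs_re_le_norm (L z)).trans h2)
  rw [hexp z hzR, mul_comm ‖h 0‖]
  exact ⟨by gcongr; exact h3.1, by gcongr; exact h3.2⟩

namespace Gen
variable {α : ℝ} {μ : ℕ → ℂ} {G g0 : ℂ → ℂ}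

lemma zero_ne (h : Gen α μ G g0) : G 0 ≠ 0 := by
  intro h0
  obtain ⟨k, hk⟩ := h.zero_mem 0 h0
  exact h.nec.ne k hk.symm

lemma growth (h : Gen α μ G g0) : ∃ a b : ℝ, 0 < a ∧ 0 < b ∧ ∀ w, 1 ≤ ‖w‖ →
    ‖G w‖ ≤ Real.exp (a + b * (Real.log ‖w‖) ^ 2) * ‖G 0‖ := by
  obtain ⟨K, hK, hp⟩ := pointwise_bound α h.nec.hα g0 h.mem
  have hc := norm_pos_iff.2 (h.nec.ne 0)
  have hG := norm_pos_iff.2 h.zero_ne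
  have hα := h.nec.hα
  set T := (1 + 1/‖μ 0‖) * K / ‖G 0‖ with hT
  have hT0 : 0 < T := by positivity
  refine ⟨|Real.log T| + 1, α + 1, by positivity, by positivity, fun w hw => ?_⟩
  have hw0 : w ≠ 0 := by intro h; rw [h, norm_zero] at hw; linarith
  have h1 : ‖g0 w‖ ≤ K * Real.exp (α * (Real.log ‖w‖) ^ 2) := by
    have h2 := hp w hw0
    have h3 : 1 ≤ ‖w‖ ^ (3/2:ℝ) := Real.one_le_rpow hw (by norm_num)
    have h4 : phi α w = α * (Real.log ‖w‖) ^ 2 := by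
      unfold phi logPlus; rw [max_eq_left (Real.log_nonneg hw)]
    unfold wt0 at h2
    rw [h4] at h2
    have h5 : ‖g0 w‖ * Real.exp (-(α * (Real.log ‖w‖) ^ 2)) ≤ K := by
      refine le_trans ?_ h2
      gcongr
      exact le_mul_of_one_le_left (Real.exp_pos _).le h3
    rw [Real.exp_neg, ← div_eq_mul_inv, div_le_iff₀ (Real.exp_pos _)] at h5
    exact h5
  have h2 : ‖1 - w / μ 0‖ ≤ (1 + 1/‖μ 0‖) * Real.exp (1 + (Real.log ‖w‖)^2) := by
    refine (norm_sub_le _ _).trans ?_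
    rw [norm_one, norm_div]
    have h3 : ‖w‖ ≤ Real.exp (1 + (Real.log ‖w‖)^2) := by
      rw [← Real.log_le_iff_le_exp (by linarith)]
      nlinarith [sq_nonneg (Real.log ‖w‖ - 1), sq_nonneg (Real.log ‖w‖)]
    calc 1 + ‖w‖ / ‖μ 0‖ ≤ ‖w‖ + ‖w‖ / ‖μ 0‖ := by linarith
      _ = (1 + 1/‖μ 0‖) * ‖w‖ := by ring
      _ ≤ _ := by gcongr
  rw [h.eq w, norm_mul]
  calc _ ≤ ((1 + 1/‖μ 0‖) * Real.exp (1 + (Real.log ‖w‖)^2)) * (K * Real.exp (α * (Real.log ‖w‖) ^ 2)) := by gcongr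
    _ = T * Real.exp (1 + (α + 1) * (Real.log ‖w‖)^2) * ‖G 0‖ := by
      rw [hT]
      have : Real.exp (1 + (α + 1) * (Real.log ‖w‖)^2) = Real.exp (1 + (Real.log ‖w‖)^2) * Real.exp (α * (Real.log ‖w‖) ^ 2) := by
        rw [← Real.exp_add]; congr 1; ring
      rw [this]; field_simp
    _ ≤ Real.exp |Real.log T| * Real.exp (1 + (α + 1) * (Real.log ‖w‖)^2) * ‖G 0‖ := by
      gcongr
      rw [← Real.log_le_iff_le_exp hT0]
      exact le_abs_self _
    _ = _ := by rw [← Real.exp_add]; congr 2; ring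

/-- The quotient by the first `n` factors. -/
lemma quot (h : Gen α μ G g0) (k : ℕ) : ∃ n > k, ∃ f : ℂ → ℂ, Differentiable ℂ f ∧
    (∀ z, G z = (∏ i ∈ Finset.range n, (1 - z / μ i)) * f z) ∧
    Real.exp (-1) * ‖G 0‖ ≤ ‖f (μ k)‖ ∧ ‖f (μ k)‖ ≤ Real.exp 1 * ‖G 0‖ := by
  obtain ⟨κ, B, hκ, hG⟩ := h.grow
  obtain ⟨a, b, ha, hb, hgr⟩ := h.growth
  have ht := hG.tendsto hκ h.nec.ne
  have ht4 : Filter.Tendsto (fun n => 4 * ‖μ n‖) Filter.atTop Filter.atTop := ht.const_mul_atTop (by norm_num)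
  have hlo : Filter.Tendsto (fun x : ℝ => (a + b * (Real.log x) ^ 2) / x) Filter.atTop (nhds 0) := by
    have h1 := (Real.isLittleO_pow_log_id_atTop (n := 2)).tendsto_div_nhds_zero
    have h2 : Filter.Tendsto (fun x : ℝ => a / x) Filter.atTop (nhds 0) :=
      Filter.Tendsto.div_atTop tendsto_const_nhds Filter.tendsto_id
    have h3 := h2.add (h1.const_mul b)
    simp only [mul_zero, add_zero] at h3
    refine h3.congr (fun x => ?_)
    simp only [id]; ring
  have hk := norm_pos_iff.2 (h.nec.ne k)
  have e1 := (hlo.comp ht4).eventually_lt_const (u := 1 / (16 * ‖μ k‖)) (by positivity)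
  obtain ⟨n, hn1, hn2, hn3, hn4⟩ := (e1.and ((Filter.eventually_gt_atTop k).and
    ((ht.eventually_gt_atTop (2 * ‖μ k‖)).and (ht.eventually_ge_atTop 1)))).exists
  simp only [Function.comp] at hn1
  obtain ⟨f, hf, e⟩ := div_finset G h.diff μ h.nec.inj h.nec.ne (Finset.range n) (fun i _ => h.zeros i)
  refine ⟨n, hn2, f, hf, e, ?_⟩
  have hf0 : f 0 = G 0 := by rw [e 0]; simp
  set R := ‖μ n‖ with hR
  set M := a + b * (Real.log (4 * R)) ^ 2 with hM
  have hMpos : 0 < M := by positivity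
  have hnz : ∀ z, ‖z‖ < R → f z ≠ 0 := by
    intro z hz hfz
    have hGz : G z = 0 := by rw [e, hfz, mul_zero]
    obtain ⟨i, rfl⟩ := h.zero_mem z hGz
    have hin : i ∈ Finset.range n := by
      rw [Finset.mem_range]
      by_contra hcon
      exact absurd (h.nec.mono n i (by omega)) (by linarith)
    apply h.deriv_ne i
    have e2 : G = fun z => (1 - z / μ i) * ((∏ i ∈ (Finset.range n).erase i, (1 - z / μ i)) * f z) := by
      funext z
      rw [e z, ← mul_assoc, Finset.mul_prod_erase _ (fun i => 1 - z / μ i) hin]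
    have hd1 : DifferentiableAt ℂ (fun z => (1 - z / μ i)) (μ i) := by fun_prop
    have hd2 : DifferentiableAt ℂ (fun z => (∏ i ∈ (Finset.range n).erase i, (1 - z / μ i))) (μ i) := by fun_prop
    rw [e2, deriv_fun_mul hd1 (hd2.fun_mul (hf _)), hfz, div_self (h.nec.ne i)]
    simp
  have hbd : ∀ z, ‖z‖ < R → ‖f z‖ ≤ Real.exp M * ‖f 0‖ := by
    intro z hz
    refine max_circle f hf (4 * R) _ (by linarith) ?_ z (by linarith)
    intro w hw
    rw [hf0, hM, ← hw]
    refine le_trans ?_ (hgr w (by linarith))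
    rw [e w, norm_mul]
    refine le_mul_of_one_le_left (norm_nonneg _) ?_
    rw [norm_prod]
    refine Finset.one_le_prod fun i hi => ?_
    have h1 : ‖μ i‖ ≤ R := h.nec.mono i n (Finset.mem_range.1 hi).le
    have h2 := norm_pos_iff.2 (h.nec.ne i)
    have h3 : 2 ≤ ‖w / μ i‖ := by
      rw [norm_div, le_div_iff₀ h2, hw]; linarith
    have h4 := norm_sub_norm_le (w / μ i) 1
    rw [norm_one, norm_sub_rev] at h4
    linarith
  have := bc_bound f hf R M (by linarith) hMpos hnz hbd (μ k) hn3
  rw [hf0] at this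
  have hle : 4 * M * ‖μ k‖ / R ≤ 1 := by
    rw [div_lt_div_iff₀ (by linarith) (by positivity)] at hn1
    rw [div_le_one (by linarith)]
    linarith
  constructor
  · refine le_trans ?_ this.1
    gcongr
  · refine this.2.trans ?_
    gcongr
end Gen

namespace Gen
variable {α : ℝ} {μ : ℕ → ℂ} {G g0 : ℂ → ℂ}

lemma deriv_prod (h : Gen α μ G g0) (k n : ℕ) (hk : k < n) (f : ℂ → ℂ) (hf : Differentiable ℂ f)
    (e : ∀ z, G z = (∏ i ∈ Finset.range n, (1 - z / μ i)) * f z) :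
    ‖deriv G (μ k)‖ * ‖μ k‖ = (∏ i ∈ (Finset.range n).erase k, ‖1 - μ k / μ i‖) * ‖f (μ k)‖ := by
  have hin : k ∈ Finset.range n := Finset.mem_range.2 hk
  have e2 : G = fun z => (1 - z / μ k) * ((∏ i ∈ (Finset.range n).erase k, (1 - z / μ i)) * f z) := by
    funext z
    rw [e z, ← mul_assoc, Finset.mul_prod_erase _ (fun i => 1 - z / μ i) hin]
  have hd1 : HasDerivAt (fun z => (1 - z / μ k)) (-(1 / μ k)) (μ k) := by
    simpa using ((hasDerivAt_id (μ k)).div_const (μ k)).const_sub 1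
  have hd2 : DifferentiableAt ℂ (fun z => (∏ i ∈ (Finset.range n).erase k, (1 - z / μ i))) (μ k) := by fun_prop
  have hne := norm_pos_iff.2 (h.nec.ne k)
  conv_lhs => rw [e2]
  rw [deriv_fun_mul hd1.differentiableAt (hd2.fun_mul (hf _)), hd1.deriv, div_self (h.nec.ne k), sub_self, zero_mul,
    add_zero, norm_mul, norm_neg, norm_div, norm_one, norm_mul, norm_prod]
  field_simp

lemma logD (h : Gen α μ G g0) : ∃ A : ℝ, ∀ k : ℕ,
    |Real.log (‖deriv G (μ k)‖ * ‖μ k‖ * wt0 α (μ k)) -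
      (∑ i ∈ Finset.range k, (Real.log ‖μ k‖ - Real.log ‖μ i‖) + 3/2 * Real.log ‖μ k‖ - phi α (μ k))| ≤ A := by
  obtain ⟨κ, B, hκ, hG⟩ := h.grow
  obtain ⟨c, hc, hc1, hs⟩ := h.nec.sep
  obtain ⟨A1, hA1, hu⟩ := prod_upper κ hκ B
  obtain ⟨A2, hA2, hl⟩ := prod_lower κ hκ B c hc hc1
  have hG0 := norm_pos_iff.2 h.zero_ne
  refine ⟨|Real.log (A1 * (Real.exp 1 * ‖G 0‖))| + |Real.log (A2 * (Real.exp (-1) * ‖G 0‖))|, fun k => ?_⟩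
  obtain ⟨n, hn, f, hf, e, hf1, hf2⟩ := h.quot k
  have hk := norm_pos_iff.2 (h.nec.ne k)
  have hw := wt0_pos α _ (h.nec.ne k)
  have hd := norm_pos_iff.2 (h.deriv_ne k)
  have hfil : ((Finset.range n).erase k).filter (· < k) = Finset.range k := by
    ext i; simp only [Finset.mem_filter, Finset.mem_erase, Finset.mem_range]; omega
  have e1 := h.deriv_prod k n hn f hf e
  have u1 := hu μ ((Finset.range n).erase k) k (μ k) h.nec.ne (hG.lev _ k)
  have l1 := hl μ ((Finset.range n).erase k) k (μ k) h.nec.ne (h.nec.ne k) (hG.lev _ k) (by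
    intro i hi
    have hne := Finset.ne_of_mem_erase hi
    refine ⟨hs i k hne, ?_⟩
    rw [norm_sub_rev]; exact hs k i hne.symm)
  rw [hfil] at u1 l1
  set P := ∏ i ∈ Finset.range k, (‖μ k‖ / ‖μ i‖) with hP
  have hP0 : 0 < P := Finset.prod_pos fun i _ => div_pos hk (norm_pos_iff.2 (h.nec.ne i))
  have hlogP : Real.log P = ∑ i ∈ Finset.range k, (Real.log ‖μ k‖ - Real.log ‖μ i‖) := by
    rw [hP, Real.log_prod (fun i _ => (div_pos hk (norm_pos_iff.2 (h.nec.ne i))).ne')]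
    exact Finset.sum_congr rfl fun i _ => Real.log_div hk.ne' (norm_pos_iff.2 (h.nec.ne i)).ne'
  have hlogw : Real.log (wt0 α (μ k)) = 3/2 * Real.log ‖μ k‖ - phi α (μ k) := by
    unfold wt0
    rw [Real.log_mul (by positivity) (Real.exp_pos _).ne', Real.log_rpow hk, Real.log_exp]; ring
  have h1 : ‖deriv G (μ k)‖ * ‖μ k‖ ≤ (A1 * (Real.exp 1 * ‖G 0‖)) * P := by
    rw [e1]
    calc _ ≤ (A1 * P) * (Real.exp 1 * ‖G 0‖) := by gcongr
      _ = _ := by ring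
  have h2 : (A2 * (Real.exp (-1) * ‖G 0‖)) * P ≤ ‖deriv G (μ k)‖ * ‖μ k‖ := by
    rw [e1]
    calc _ = (A2 * P) * (Real.exp (-1) * ‖G 0‖) := by ring
      _ ≤ _ := by gcongr
  have h1' := Real.log_le_log (by positivity) h1
  have h2' := Real.log_le_log (by positivity) h2
  rw [Real.log_mul (by positivity) hP0.ne', hlogP] at h1' h2'
  rw [Real.log_mul (by positivity) hw.ne', hlogw, abs_le]
  have t1 := neg_abs_le (Real.log (A1 * (Real.exp 1 * ‖G 0‖)))
  have t2 := le_abs_self (Real.log (A1 * (Real.exp 1 * ‖G 0‖)))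
  have t3 := neg_abs_le (Real.log (A2 * (Real.exp (-1) * ‖G 0‖)))
  have t4 := le_abs_self (Real.log (A2 * (Real.exp (-1) * ‖G 0‖)))
  constructor <;> linarith

/-- `U_k` -/
lemma final (h : Gen α μ G g0) : ∃ η A : ℝ, 0 < η ∧ ∀ j k : ℕ, j ≤ k →
    η * ((k:ℝ) - j) - A ≤
      (∑ i ∈ Finset.range k, (Real.log ‖μ k‖ - Real.log ‖μ i‖) + 3/2 * Real.log ‖μ k‖ - α * (Real.log ‖μ k‖)^2) -
      (∑ i ∈ Finset.range j, (Real.log ‖μ j‖ - Real.log ‖μ i‖) + 3/2 * Real.log ‖μ j‖ - α * (Real.log ‖μ j‖)^2) ∧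
      (∑ i ∈ Finset.range k, (Real.log ‖μ k‖ - Real.log ‖μ i‖) + 3/2 * Real.log ‖μ k‖ - α * (Real.log ‖μ k‖)^2) -
      (∑ i ∈ Finset.range j, (Real.log ‖μ j‖ - Real.log ‖μ i‖) + 3/2 * Real.log ‖μ j‖ - α * (Real.log ‖μ j‖)^2) ≤
      Real.log ‖μ k‖ - Real.log ‖μ j‖ - η * ((k:ℝ) - j) + A := by
  obtain ⟨η, A, hη, h1⟩ := h.two'
  obtain ⟨A', hA'⟩ := h.logD
  have hα := h.nec.hα
  have hphi : ∀ k, |phi α (μ k) - α * (Real.log ‖μ k‖)^2| ≤ α * (Real.log ‖μ 0‖)^2 := by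
    intro k
    unfold phi logPlus
    by_cases hk : 0 ≤ Real.log ‖μ k‖
    · rw [max_eq_left hk, sub_self, abs_zero]; positivity
    · push Not at hk
      rw [max_eq_right hk.le]
      have h0 : Real.log ‖μ 0‖ ≤ Real.log ‖μ k‖ :=
        Real.log_le_log (norm_pos_iff.2 (h.nec.ne 0)) (h.nec.mono 0 k (Nat.zero_le _))
      have : (Real.log ‖μ k‖)^2 ≤ (Real.log ‖μ 0‖)^2 := by nlinarith
      have h3 : α * (Real.log ‖μ k‖)^2 ≤ α * (Real.log ‖μ 0‖)^2 := by gcongr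
      have h4 : 0 ≤ α * (Real.log ‖μ k‖)^2 := by positivity
      rw [abs_le]; constructor <;> linarith
  refine ⟨η, A + 2 * A' + 2 * (α * (Real.log ‖μ 0‖)^2), hη, fun j k hjk => ?_⟩
  obtain ⟨h2, h3⟩ := h1 j k hjk
  have a1 := abs_le.1 (hA' j)
  have a2 := abs_le.1 (hA' k)
  have b1 := abs_le.1 (hphi j)
  have b2 := abs_le.1 (hphi k)
  constructor <;> linarith

end Gen

/-- The quantity `U_k`. -/
def UU (α : ℝ) (s : ℕ → ℝ) (k : ℕ) : ℝ := ∑ i ∈ Finset.range k, (s k - s i) + 3/2 * s k - α * (s k)^2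

lemma UU_succ (α : ℝ) (s : ℕ → ℝ) (k : ℕ) :
    UU α s (k + 1) - UU α s k = (s (k+1) - s k) * ((k:ℝ) + 5/2 - α * (s (k+1) + s k)) := by
  unfold UU
  rw [Finset.sum_sub_distrib, Finset.sum_sub_distrib, Finset.sum_range_succ s]
  simp only [Finset.sum_const, Finset.card_range, nsmul_eq_mul]
  push_cast
  ring

lemma UU_eps (α : ℝ) (hα : 0 < α) (s ε : ℕ → ℝ) (hs : ∀ k, s k = ((k:ℝ) + 3/2) / (2 * α) + ε k) (k : ℕ) :
    UU α s k = ((k:ℝ) + 9/4) / (4 * α) - Esum ε k - α * (ε k)^2 := by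
  induction k with
  | zero =>
    simp only [UU, Esum, Finset.range_zero, Finset.sum_empty, hs 0]
    push_cast
    field_simp
    ring
  | succ k ih =>
    have h1 := UU_succ α s k
    have h2 : Esum ε (k+1) = Esum ε k + ε k := Finset.sum_range_succ _ _
    rw [sub_eq_iff_eq_add] at h1
    rw [h1, ih, h2, hs, hs]
    push_cast
    field_simp
    ring

lemma seq_core (α : ℝ) (hα : 0 < α) (s ε : ℕ → ℝ) (hs : ∀ k, s k = ((k:ℝ) + 3/2) / (2 * α) + ε k)
    (hm : ∀ i j, i ≤ j → s i ≤ s j) (η A : ℝ) (hη : 0 < η)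
    (hU : ∀ j k : ℕ, j ≤ k → η * ((k:ℝ) - j) - A ≤ UU α s k - UU α s j ∧
      UU α s k - UU α s j ≤ s k - s j - η * ((k:ℝ) - j) + A) :
    ∃ M C : ℝ, (∀ k, |ε k| ≤ M) ∧ ∀ j k : ℕ, j ≤ k →
      |Esum ε k - Esum ε j| ≤ (1 / (4 * α) - η) * ((k:ℝ) - j) + C := by
  have hA : 0 ≤ A := by
    have := (hU 0 0 le_rfl).1
    simp at this; exact this
  set b : ℕ → ℝ := fun k => (k:ℝ) + 3/2 - 2 * α * s k with hb
  have hbe : ∀ k, ε k = -b k / (2 * α) := by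
    intro k; simp only [hb, hs k]; field_simp; ring
  have hbm : ∀ i m : ℕ, b (i + m) ≤ b i + m := by
    intro i m
    have := hm i (i + m) (by omega)
    simp only [hb]; push_cast; nlinarith
  have hstep : ∀ k, UU α s (k + 1) - UU α s k = (s (k+1) - s k) * ((b k + b (k + 1) + 1) / 2) := by
    intro k; rw [UU_succ]; simp only [hb]; push_cast; ring
  have hup : ∀ j m : ℕ, UU α s (j + m) - UU α s j ≤ (s (j + m) - s j) * (b j + m) := by
    intro j m
    induction m with
    | zero => simp
    | succ m ih =>
      have h1 := hstep (j + m)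
      have h2 := hm (j + m) (j + m + 1) (by omega)
      have h3 := hm j (j + m) (by omega)
      have h4 := hbm j m
      have h5 := hbm j (m + 1)
      have h6 : (b (j + m) + b (j + m + 1) + 1) / 2 ≤ b j + m + 1 := by
        rw [← add_assoc] at h5; push_cast at h5; linarith
      have h7 : (s (j+m+1) - s (j+m)) * ((b (j+m) + b (j+m + 1) + 1) / 2) ≤ (s (j+m+1) - s (j+m)) * (b j + m + 1) :=
        mul_le_mul_of_nonneg_left h6 (by linarith)
      rw [← add_assoc]; push_cast
      nlinarith
  have hlow : ∀ m j : ℕ, (s (j + m) - s j) * (b (j + m) - m) ≤ UU α s (j + m) - UU α s j := by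
    intro m
    induction m with
    | zero => simp
    | succ m ih =>
      intro j
      have h0 := ih (j + 1)
      have e : j + 1 + m = j + (m + 1) := by omega
      rw [e] at h0
      have h1 := hstep j
      have h2 := hm j (j + 1) (by omega)
      have h3 := hm (j + 1) (j + (m + 1)) (by omega)
      have h4 := hbm j (m + 1)
      have h5 := hbm (j + 1) m
      rw [e] at h5
      push_cast at h4 ⊢
      have h6 : b (j + (m + 1)) - (m + 1) ≤ (b j + b (j + 1) + 1) / 2 := by linarith
      have h7 := mul_le_mul_of_nonneg_left h6 (sub_nonneg.2 h2)
      nlinarith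
  obtain ⟨L, hL⟩ := exists_nat_ge ((1 + 2 * A) / (2 * η))
  rw [div_le_iff₀ (by positivity)] at hL
  have hsL : ∀ j, 1 ≤ s (j + L) - s j := by
    intro j
    obtain ⟨h1, h2⟩ := hU j (j + L) (by omega)
    push_cast at h1 h2
    linarith
  have hblow : ∀ j, -(L:ℝ) - A ≤ b j := by
    intro j
    by_contra hcon
    push Not at hcon
    have h1 := hup j L
    have h2 := (hU j (j + L) (by omega)).1
    push_cast at h2
    have h3 : (s (j + L) - s j) * (b j + L) ≤ 1 * (b j + L) :=
      mul_le_mul_of_nonpos_right (hsL j) (by linarith)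
    have : 0 ≤ η * (((j:ℝ) + L) - j) := by
      rw [add_sub_cancel_left]; positivity
    linarith
  have hbup : ∀ j, b j ≤ (L:ℝ) + 1 + A + |b 0| := by
    intro j
    by_cases hj : j < L
    · have h1 := hbm 0 j
      rw [zero_add] at h1
      have : (j:ℝ) ≤ L := by exact_mod_cast hj.le
      linarith [le_abs_self (b 0)]
    · obtain ⟨i, rfl⟩ : ∃ i, j = i + L := ⟨j - L, by omega⟩
      by_contra hcon
      push Not at hcon
      have h0 := abs_nonneg (b 0)
      have h1 := hlow L i
      have h2 := (hU i (i + L) (by omega)).2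
      push_cast at h2
      have h3 : 1 * (b (i + L) - L - 1) ≤ (s (i + L) - s i) * (b (i + L) - L - 1) :=
        mul_le_mul_of_nonneg_right (hsL i) (by linarith)
      have : 0 ≤ η * (((i:ℝ) + L) - i) := by
        rw [add_sub_cancel_left]; positivity
      nlinarith
  set M := ((L:ℝ) + 1 + A + |b 0|) / (2 * α) with hM
  have hMb : ∀ k, |ε k| ≤ M := by
    intro k
    rw [hbe, abs_div, abs_neg, abs_of_pos (show 0 < 2 * α by positivity), hM]
    gcongr
    rw [abs_le]
    exact ⟨by linarith [hblow k, abs_nonneg (b 0)], hbup k⟩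
  refine ⟨M, A + 2 * M + α * M ^ 2, hMb, fun j k hjk => ?_⟩
  obtain ⟨h1, h2⟩ := hU j k hjk
  rw [UU_eps α hα s ε hs, UU_eps α hα s ε hs] at h1 h2
  rw [hs k, hs j] at h2
  have hsq : ∀ k, α * ε k ^ 2 ≤ α * M ^ 2 := by
    intro k
    have := sq_le_sq' (neg_le_of_abs_le (hMb k)) (le_of_abs_le (hMb k))
    gcongr
  have hsq0 : ∀ k, 0 ≤ α * ε k ^ 2 := fun k => by positivity
  have q1 := hsq j; have q2 := hsq k; have q3 := hsq0 j; have q4 := hsq0 k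
  have m1 := abs_le.1 (hMb j); have m2 := abs_le.1 (hMb k)
  have e1 : ((k:ℝ) + 9/4) / (4 * α) - ((j:ℝ) + 9/4) / (4 * α) = 1 / (4 * α) * ((k:ℝ) - j) := by ring
  have e2 : ((k:ℝ) + 3/2) / (2 * α) - ((j:ℝ) + 3/2) / (2 * α) = 2 * (1 / (4 * α) * ((k:ℝ) - j)) := by
    field_simp; ring
  have M0 : 0 ≤ M := (abs_nonneg _).trans (hMb 0)
  rw [abs_le]
  constructor <;> linarith

/-- Necessity, in terms of the sequence `μ`. -/
lemma Nec.main {α : ℝ} {μ : ℕ → ℂ} (n : Nec α μ) (ε : ℕ → ℝ)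
    (hn : ∀ m : ℕ, ‖μ m‖ = Real.exp (((m:ℝ) + 3/2) / (2 * α) + ε m)) :
    (∃ c, 0 < c ∧ c ≤ 1 ∧ SepSeq c μ) ∧ ∃ M C η : ℝ, 0 < η ∧ (∀ k, |ε k| ≤ M) ∧ ∀ j k : ℕ, j ≤ k →
      |Esum ε k - Esum ε j| ≤ (1 / (4 * α) - η) * ((k:ℝ) - j) + C := by
  refine ⟨n.sep, ?_⟩
  obtain ⟨g, hg, h1, h0⟩ := n.exists_g 0
  have hgen : Gen α μ (fun z => (1 - z / μ 0) * g z) g := ⟨n, hg, h1, h0, fun z => rfl⟩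
  obtain ⟨η, A, hη, hU⟩ := hgen.final
  obtain ⟨M, C, hM, hC⟩ := seq_core α n.hα (fun k => Real.log ‖μ k‖) ε (fun k => by rw [hn, Real.log_exp])
    (fun i j hij => Real.log_le_log (norm_pos_iff.2 (n.ne i)) (n.mono i j hij)) η A hη hU
  exact ⟨M, C, η, hη, hM, hC⟩

lemma sum_block (δ : ℕ → ℝ) (M q : ℝ) (N : ℕ) (hM : ∀ n, |δ n| ≤ M)
    (hq : ∀ n, |∑ i ∈ Finset.range N, δ (n + i)| ≤ q * N) (t r : ℕ) :
    ∀ n, |∑ i ∈ Finset.range (N * t + r), δ (n + i)| ≤ q * N * t + r * M := by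
  induction t with
  | zero =>
    intro n
    simp only [mul_zero, zero_add, Nat.cast_zero]
    refine (Finset.abs_sum_le_sum_abs _ _).trans ?_
    refine (Finset.sum_le_sum fun i _ => hM (n + i)).trans ?_
    simp
  | succ t ih =>
    intro n
    have e : N * (t + 1) + r = N + (N * t + r) := by ring
    rw [e, Finset.sum_range_add]
    refine (abs_add_le _ _).trans ?_
    have h1 := hq n
    have h2 := ih (n + N)
    simp only [add_assoc] at h2 ⊢
    push_cast
    linarith

lemma Esum_sub (ε : ℕ → ℝ) (j m : ℕ) : Esum ε (j + m) - Esum ε j = ∑ i ∈ Finset.range m, ε (j + i) := by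
  unfold Esum
  rw [Finset.sum_range_add]; ring

lemma avg_to_E (α : ℝ) (δ : ℕ → ℝ) (M : ℝ) (hM : ∀ n, |δ n| ≤ M) (N : ℕ) (hN : 1 ≤ N)
    (h1 : -(1 / (4 * α)) < ⨅ n : ℕ, avgD δ N n) (h2 : (⨆ n : ℕ, avgD δ N n) < 1 / (4 * α)) :
    ∃ η C : ℝ, 0 < η ∧ ∀ j k : ℕ, j ≤ k →
      |Esum (fun m => δ (m + 1)) k - Esum (fun m => δ (m + 1)) j| ≤ (1 / (4 * α) - η) * ((k:ℝ) - j) + C := by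
  have hN0 : (0:ℝ) < N := by exact_mod_cast hN
  have hb : ∀ n, |avgD δ N n| ≤ M := by
    intro n
    unfold avgD
    rw [abs_mul, abs_of_pos (show 0 < 1 / (N:ℝ) by positivity), one_div_mul_eq_div, div_le_iff₀ hN0]
    refine (Finset.abs_sum_le_sum_abs _ _).trans ?_
    refine (Finset.sum_le_sum fun i _ => hM (n + i)).trans ?_
    simp [mul_comm]
  have hbb : BddBelow (Set.range fun n => avgD δ N n) := ⟨-M, by rintro _ ⟨n, rfl⟩; exact (abs_le.1 (hb n)).1⟩
  have hba : BddAbove (Set.range fun n => avgD δ N n) := ⟨M, by rintro _ ⟨n, rfl⟩; exact (abs_le.1 (hb n)).2⟩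
  set q := max (⨆ n : ℕ, avgD δ N n) (-(⨅ n : ℕ, avgD δ N n)) with hq
  have hqlt : q < 1 / (4 * α) := max_lt h2 (by linarith)
  have hav : ∀ n, |avgD δ N n| ≤ q := by
    intro n
    have a1 := ciInf_le hbb n
    have a2 := le_ciSup hba n
    rw [abs_le]
    exact ⟨by linarith [le_max_right (⨆ n : ℕ, avgD δ N n) (-(⨅ n : ℕ, avgD δ N n))], a2.trans (le_max_left _ _)⟩
  have hq0 : 0 ≤ q := (abs_nonneg _).trans (hav 0)
  have hM0 : 0 ≤ M := (abs_nonneg _).trans (hM 0)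
  have hblk : ∀ n, |∑ i ∈ Finset.range N, δ (n + i)| ≤ q * N := by
    intro n
    have := hav n
    unfold avgD at this
    rw [abs_mul, abs_of_pos (show 0 < 1 / (N:ℝ) by positivity), one_div_mul_eq_div, div_le_iff₀ hN0] at this
    exact this
  refine ⟨1 / (4 * α) - q, N * M, by linarith, fun j k hjk => ?_⟩
  obtain ⟨m, rfl⟩ : ∃ m, k = j + m := ⟨k - j, by omega⟩
  rw [Esum_sub]
  have h3 := sum_block δ M q N hM hblk (m / N) (m % N) (j + 1)
  rw [Nat.div_add_mod] at h3
  have h4 : ((N:ℝ) * ((m / N : ℕ):ℝ)) ≤ m := by exact_mod_cast Nat.mul_div_le m N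
  have h5 : ((m % N : ℕ):ℝ) ≤ N := by exact_mod_cast (Nat.mod_lt m hN).le
  have e : ∑ i ∈ Finset.range m, δ (j + i + 1) = ∑ i ∈ Finset.range m, δ (j + 1 + i) :=
    Finset.sum_congr rfl fun i _ => by congr 1; ring
  rw [e]
  refine h3.trans ?_
  push_cast
  have h6 : q * (N * ((m / N : ℕ):ℝ)) ≤ q * m := by gcongr
  have h7 : ((m % N : ℕ):ℝ) * M ≤ N * M := by gcongr
  linarith

lemma E_to_avg (α : ℝ) (δ : ℕ → ℝ) (η C : ℝ) (hη : 0 < η)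
    (h : ∀ j k : ℕ, j ≤ k →
      |Esum (fun m => δ (m + 1)) k - Esum (fun m => δ (m + 1)) j| ≤ (1 / (4 * α) - η) * ((k:ℝ) - j) + C) :
    ∃ N : ℕ, 1 ≤ N ∧ -(1 / (4 * α)) < (⨅ n : ℕ, avgD δ N n) ∧ (⨆ n : ℕ, avgD δ N n) < 1 / (4 * α) := by
  set q := 1 / (4 * α) - η with hq
  have hs : ∀ n m : ℕ, |∑ i ∈ Finset.range m, δ (n + 1 + i)| ≤ q * m + C := by
    intro n m
    have := h n (n + m) (by omega)
    rw [Esum_sub] at this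
    push_cast at this
    have e : ∑ i ∈ Finset.range m, δ (n + i + 1) = ∑ i ∈ Finset.range m, δ (n + 1 + i) :=
      Finset.sum_congr rfl fun i _ => by congr 1; ring
    rw [e] at this
    linarith
  set C' := |C| + |δ 0| + |q| with hC'
  have hC'0 : 0 ≤ C' := by positivity
  have hs' : ∀ n m : ℕ, |∑ i ∈ Finset.range (m + 1), δ (n + i)| ≤ q * (m + 1) + C' := by
    intro n m
    rcases n with _ | n
    · rw [Finset.sum_range_succ']
      have h1 := hs 0 m
      have e : ∑ i ∈ Finset.range m, δ (0 + (i + 1)) = ∑ i ∈ Finset.range m, δ (0 + 1 + i) :=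
        Finset.sum_congr rfl fun i _ => by congr 1; ring
      rw [e]
      refine (abs_add_le _ _).trans ?_
      simp only [add_zero]
      linarith [le_abs_self C, neg_abs_le q]
    · have := hs n (m + 1)
      push_cast at this
      linarith [le_abs_self C, abs_nonneg q, abs_nonneg (δ 0)]
  obtain ⟨m, hm⟩ := exists_nat_ge (2 * C' / η)
  rw [div_le_iff₀ hη] at hm
  have hN0 : (0:ℝ) < ((m + 1 : ℕ):ℝ) := by positivity
  have hav : ∀ n, |avgD δ (m + 1) n| ≤ 1 / (4 * α) - η / 2 := by
    intro n
    unfold avgD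
    rw [abs_mul, abs_of_pos (show 0 < 1 / ((m + 1 : ℕ):ℝ) by positivity), one_div_mul_eq_div, div_le_iff₀ hN0]
    refine (hs' n m).trans ?_
    push_cast
    rw [hq]
    nlinarith
  refine ⟨m + 1, by omega, ?_, ?_⟩
  · have : -(1 / (4 * α) - η / 2) ≤ ⨅ n : ℕ, avgD δ (m + 1) n := le_ciInf fun n => (abs_le.1 (hav n)).1
    linarith
  · have : (⨆ n : ℕ, avgD δ (m + 1) n) ≤ 1 / (4 * α) - η / 2 := ciSup_le fun n => (abs_le.1 (hav n)).2
    linarith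

lemma dsep_to (α : ℝ) (hα : 0 < α) (γ : ℕ → ℂ) (hinj : Function.Injective γ)
    (h : DRhoSeparated α (Set.range γ)) : ∃ c, 0 < c ∧ c ≤ 1 ∧ SepSeq c γ := by
  obtain ⟨ε, hε, hs⟩ := h
  set r := Real.sqrt (2 * α) with hr
  have hr0 : 0 < r := Real.sqrt_pos.2 (by positivity)
  set c := ε / r with hc
  have hc0 : 0 < c := by positivity
  refine ⟨c / (1 + c), by positivity, by rw [div_le_one (by positivity)]; linarith, fun i k hik => ?_⟩
  have h1 := hs (γ i) ⟨i, rfl⟩ (γ k) ⟨k, rfl⟩ (fun hh => hik (hinj hh))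
  unfold dRho rhoF at h1
  rw [← hr, le_div_iff₀ (by positivity), min_div_div_right hr0.le] at h1
  have h2 : c * min ‖γ i‖ ‖γ k‖ ≤ ‖γ i - γ k‖ := by
    refine le_trans ?_ h1
    rw [hc, mul_add, mul_one, div_mul_eq_mul_div, mul_div_assoc]
    linarith
  have h3 : ‖γ k‖ ≤ min ‖γ i‖ ‖γ k‖ + ‖γ i - γ k‖ := by
    have h4 := norm_sub_norm_le (γ k) (γ i)
    rw [norm_sub_rev] at h4
    rcases min_choice ‖γ i‖ ‖γ k‖ with h5 | h5 <;> rw [h5]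
    · linarith
    · linarith [norm_nonneg (γ i - γ k)]
  rw [div_mul_eq_mul_div, div_le_iff₀ (by positivity)]
  nlinarith

lemma to_dsep (α : ℝ) (hα : 0 < α) (γ : ℕ → ℂ) (hne : γ 0 ≠ 0) (hm : ∀ k, ‖γ 0‖ ≤ ‖γ k‖)
    (c : ℝ) (hc : 0 < c) (h : SepSeq c γ) : DRhoSeparated α (Set.range γ) := by
  set r := Real.sqrt (2 * α) with hr
  have hr0 : 0 < r := Real.sqrt_pos.2 (by positivity)
  have h0 := norm_pos_iff.2 hne
  refine ⟨c / (1 / ‖γ 0‖ + 1 / r), by positivity, ?_⟩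
  rintro _ ⟨i, rfl⟩ _ ⟨k, rfl⟩ hik
  have h1 := h i k (fun hh => hik (by rw [hh]))
  unfold dRho rhoF
  rw [← hr, div_le_div_iff₀ (by positivity) (by positivity)]
  have h2 : 1 + min (‖γ i‖ / r) (‖γ k‖ / r) ≤ (1 / ‖γ 0‖ + 1 / r) * ‖γ k‖ := by
    have h3 : 1 ≤ 1 / ‖γ 0‖ * ‖γ k‖ := by
      rw [one_div_mul_eq_div, one_le_div h0]; exact hm k
    have h4 := min_le_right (‖γ i‖ / r) (‖γ k‖ / r)
    have h5 : 1 / r * ‖γ k‖ = ‖γ k‖ / r := by ring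
    linarith
  calc _ ≤ c * ((1 / ‖γ 0‖ + 1 / r) * ‖γ k‖) := by gcongr
    _ = c * ‖γ k‖ * (1 / ‖γ 0‖ + 1 / r) := by ring
    _ ≤ _ := by gcongr

lemma sep_first (γ : ℕ → ℂ) (hinj : Function.Injective γ) (hm : ∀ k, ‖γ 0‖ ≤ ‖γ k‖) (h0 : γ 0 ≠ 0)
    (ht : Filter.Tendsto (fun n => ‖γ n‖) Filter.atTop Filter.atTop) :
    ∃ c, 0 < c ∧ ∀ k, k ≠ 0 → c * ‖γ k‖ ≤ ‖γ k - γ 0‖ := by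
  have hfin : ∀ K : ℕ, ∃ c, 0 < c ∧ ∀ k, k < K → k ≠ 0 → c * ‖γ k‖ ≤ ‖γ k - γ 0‖ := by
    intro K
    induction K with
    | zero => exact ⟨1, one_pos, fun k hk => absurd hk (by omega)⟩
    | succ K ih =>
      obtain ⟨c, hc, h⟩ := ih
      by_cases hK : K = 0
      · subst hK; exact ⟨1, one_pos, fun k hk hk0 => absurd hk (by omega)⟩
      have hp : 0 < ‖γ K‖ := (norm_pos_iff.2 h0).trans_le (hm K)
      have hp2 : 0 < ‖γ K - γ 0‖ := norm_pos_iff.2 (sub_ne_zero.2 fun hh => hK (hinj hh))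
      refine ⟨min c (‖γ K - γ 0‖ / ‖γ K‖), by positivity, fun k hk hk0 => ?_⟩
      rcases Nat.lt_succ_iff_lt_or_eq.1 hk with h1 | h1
      · exact (mul_le_mul_of_nonneg_right (min_le_left _ _) (norm_nonneg _)).trans (h k h1 hk0)
      · subst h1
        refine (mul_le_mul_of_nonneg_right (min_le_right _ _) (norm_nonneg _)).trans ?_
        rw [div_mul_cancel₀ _ hp.ne']
  obtain ⟨K, hK⟩ := Filter.eventually_atTop.1 (ht.eventually_ge_atTop (2 * ‖γ 0‖))
  obtain ⟨c, hc, h⟩ := hfin K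
  refine ⟨min c (1/2), by positivity, fun k hk => ?_⟩
  by_cases hkK : k < K
  · exact (mul_le_mul_of_nonneg_right (min_le_left _ _) (norm_nonneg _)).trans (h k hkK hk)
  · have h1 := hK k (by omega)
    refine (mul_le_mul_of_nonneg_right (min_le_right _ _) (norm_nonneg _)).trans ?_
    have := norm_sub_norm_le (γ k) (γ 0)
    linarith

lemma sep_scale (E : ℝ) (hE : 0 < E) (c : ℝ) (γ : ℕ → ℂ) (i k : ℕ) :
    c * ‖(E:ℂ) * γ k‖ ≤ ‖(E:ℂ) * γ i - (E:ℂ) * γ k‖ ↔ c * ‖γ k‖ ≤ ‖γ i - γ k‖ := by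
  rw [← mul_sub, norm_mul, norm_mul, norm_real, Real.norm_of_nonneg hE.le, mul_left_comm]
  exact mul_le_mul_iff_of_pos_left hE

/-- for `p = 4/3`, `(e^{-1/(4α)}Γ) ∖ {e^{-1/(4α)}γ₀}` is a complete
interpolating sequence for `F^{4/3}_φ` iff `Γ` is `d_ρ`-separated, `(δ_n)` is bounded,
and `-1/(4α) < ∇_N ≤ Δ_N < 1/(4α)` for some `N ≥ 1`. -/
theorem statement3 (α : ℝ) (hα : 0 < α)
    (γ : ℕ → ℂ) (hinj : Function.Injective γ)
    (hmono : ∀ n, ‖γ n‖ ≤ ‖γ (n + 1)‖)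
    (δ θ : ℕ → ℝ)
    (hdecomp : ∀ n, γ n =
      (Real.exp ((1 + (n : ℝ)) / (2 * α) + δ n) : ℂ) * Complex.exp ((θ n : ℂ) * Complex.I)) :
    CompleteInterpolating α (4 / 3)
        {w : ℂ | ∃ n : ℕ, 1 ≤ n ∧ w = (Real.exp (-(1 / (4 * α))) : ℂ) * γ n} ↔
      (DRhoSeparated α (Set.range γ) ∧
       (∃ M : ℝ, ∀ n, |δ n| ≤ M) ∧
       (∃ N : ℕ, 1 ≤ N ∧
         -(1 / (4 * α)) < (⨅ n : ℕ, avgD δ N n) ∧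
         (⨆ n : ℕ, avgD δ N n) < 1 / (4 * α))) := by
  have hnorm : ∀ n, ‖γ n‖ = Real.exp ((1 + (n : ℝ)) / (2 * α) + δ n) := by
    intro n
    rw [hdecomp n, norm_mul, norm_exp_ofReal_mul_I, mul_one, norm_real, Real.norm_of_nonneg (Real.exp_pos _).le]
  have hmono' : ∀ i j, i ≤ j → ‖γ i‖ ≤ ‖γ j‖ := fun i j hij => monotone_nat_of_le_succ hmono hij
  have hpos : ∀ n, 0 < ‖γ n‖ := fun n => by rw [hnorm]; exact Real.exp_pos _
  set E := Real.exp (-(1 / (4 * α))) with hE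
  have hE0 : 0 < E := Real.exp_pos _
  set μ : ℕ → ℂ := fun m => (E : ℂ) * γ (m + 1) with hμ
  set ε : ℕ → ℝ := fun m => δ (m + 1) with hε
  have hset : {w : ℂ | ∃ n : ℕ, 1 ≤ n ∧ w = (E : ℂ) * γ n} = Set.range μ := by
    ext w
    constructor
    · rintro ⟨n, hn, rfl⟩
      exact ⟨n - 1, by simp only [hμ, Nat.sub_add_cancel hn]⟩
    · rintro ⟨m, rfl⟩
      exact ⟨m + 1, by omega, rfl⟩
  rw [hset]
  have hEc : (E:ℂ) ≠ 0 := by exact_mod_cast hE0.ne'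
  have hμn : ∀ m, ‖μ m‖ = E * ‖γ (m + 1)‖ := by
    intro m
    rw [hμ, norm_mul, norm_real, Real.norm_of_nonneg hE0.le]
  have hμexp : ∀ m : ℕ, ‖μ m‖ = Real.exp (((m:ℝ) + 3/2) / (2 * α) + ε m) := by
    intro m
    rw [hμn, hnorm, hE, ← Real.exp_add]
    congr 1
    simp only [hε]; push_cast; field_simp; ring
  have hμinj : Function.Injective μ := by
    intro a b hab
    have := hinj (mul_left_cancel₀ hEc hab)
    omega
  have hμmono : ∀ i j, i ≤ j → ‖μ i‖ ≤ ‖μ j‖ := by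
    intro i j hij
    rw [hμn, hμn]
    exact mul_le_mul_of_nonneg_left (hmono' _ _ (by omega)) hE0.le
  constructor
  · intro hci
    have hnec : Nec α μ := ⟨hα, hμinj, fun k => norm_pos_iff.1 (by rw [hμexp]; exact Real.exp_pos _), hμmono, hci⟩
    obtain ⟨⟨c, hc, hc1, hsep⟩, M, C, η, hη, hM, hC⟩ := hnec.main ε hμexp
    have hbd : ∀ n, |δ n| ≤ max M |δ 0| := by
      intro n
      rcases n with _ | n
      · exact le_max_right _ _
      · exact (hM n).trans (le_max_left _ _)
    refine ⟨?_, ⟨_, hbd⟩, E_to_avg α δ η C hη hC⟩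
    have h0 : γ 0 ≠ 0 := norm_pos_iff.1 (hpos 0)
    have hm0 : ∀ k, ‖γ 0‖ ≤ ‖γ k‖ := fun k => hmono' 0 k (Nat.zero_le _)
    have ht : Filter.Tendsto (fun n => ‖γ n‖) Filter.atTop Filter.atTop := by
      simp only [hnorm]
      refine Real.tendsto_exp_atTop.comp ?_
      refine Filter.tendsto_atTop_add_right_of_le _ (-(max M |δ 0|)) ?_ (fun n => (abs_le.1 (hbd n)).1)
      refine Filter.Tendsto.atTop_div_const (by positivity) ?_
      exact Filter.tendsto_atTop_add_const_left _ _ tendsto_natCast_atTop_atTop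
    obtain ⟨c0, hc0, h1⟩ := sep_first γ hinj hm0 h0 ht
    refine to_dsep α hα γ h0 hm0 (min c c0) (by positivity) ?_
    intro i k hik
    rcases k with _ | k
    · refine le_trans ?_ (h1 i hik)
      calc _ ≤ c0 * ‖γ 0‖ := mul_le_mul_of_nonneg_right (min_le_right _ _) (norm_nonneg _)
        _ ≤ _ := mul_le_mul_of_nonneg_left (hm0 i) hc0.le
    · rcases i with _ | i
      · rw [norm_sub_rev]
        exact (mul_le_mul_of_nonneg_right (min_le_right _ _) (norm_nonneg _)).trans (h1 (k + 1) (by omega))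
      · have h2 := hsep i k (by omega)
        have h3 := (sep_scale E hE0 c (fun m => γ (m + 1)) i k).1 h2
        exact (mul_le_mul_of_nonneg_right (min_le_left _ _) (norm_nonneg _)).trans h3
  · rintro ⟨hd, ⟨M, hM⟩, N, hN, h1, h2⟩
    obtain ⟨c, hc, hc1, hsep⟩ := dsep_to α hα γ hinj hd
    obtain ⟨η, C, hη, hC⟩ := avg_to_E α δ M hM N hN h1 h2
    have hsep' : SepSeq c μ := fun i k hik =>
      (sep_scale E hE0 c (fun m => γ (m + 1)) i k).2 (hsep (i + 1) (k + 1) (by omega))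
    have g : Good α μ ε M c η C := ⟨hα, hμexp, hμinj, hμmono, fun m => hM (m + 1), hc, hc1, hsep', hη, hC⟩
    exact g.ci

end
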